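/- arXiv:1312.4600 — 4 statements merged into one kernel-verified Lean document; each statement's English description precedes it below -/
import Mathlib

section
/- Let L = 3 and let i be an integer. Suppose f is a smooth real-valued (or ℝ^K-valued) function on the closed annulus A_{i-1} ∪ A_i ∪ A_{i+1} = {x ∈ ℝ⁴ : e^{-(i+1)L} ≤ |x| ≤ e^{-(i-2)L}} which is biharmonic (Δ²f = 0) on its interior, is not identically zero, and whose mean value over every sphere {|x| = r} (with respect to the 3-dimensional surface measure) vanishes for all r ∈ [e^{-(i+1)L}, e^{-(i-2)L}]. Then 2·F_i(f) < e^{−L}·(F_{i−1}(f) + F_{i+1}(f)). -/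
open MeasureTheory Metric

noncomputable section

/-- The Euclidean Laplacian of a function on ℝ⁴ (as trace of the second derivative). -/
noncomputable def lap {V : Type*} [NormedAddCommGroup V] [NormedSpace ℝ V]
    (f : EuclideanSpace ℝ (Fin 4) → V) (x : EuclideanSpace ℝ (Fin 4)) : V :=
  ∑ i : Fin 4,
    iteratedFDeriv ℝ 2 f x ![EuclideanSpace.single i (1 : ℝ), EuclideanSpace.single i (1 : ℝ)]

/-- `Fweight L i f = ∫_{A_i} f² |x|⁻⁴ dx` over the annulus
`A_i = {e^{-iL} ≤ |x| ≤ e^{-(i-1)L}}`. -/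
noncomputable def Fweight (L : ℝ) (i : ℤ) (f : EuclideanSpace ℝ (Fin 4) → ℝ) : ℝ :=
  ∫ x in {x : EuclideanSpace ℝ (Fin 4) |
      Real.exp (-(i : ℝ) * L) ≤ ‖x‖ ∧ ‖x‖ ≤ Real.exp (-((i : ℝ) - 1) * L)},
    (f x) ^ 2 / ‖x‖ ^ 4

section OneDim

open Real

/-- The boundary term coming from the antiderivative of `cosh (n t) ^ 2`. -/
def radialBoundary (n : ℝ) : ℝ :=
  (sinh (9 * n) - (1 + 2 * exp 3) * sinh (3 * n)) / (4 * n)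

lemma exp_three_bounds : 20 < exp 3 ∧ exp 3 < 20.1 := by
  have h : exp 3 = exp 1 ^ 3 := by rw [← exp_nat_mul]; norm_num
  have h1 := exp_one_gt_d9
  have h2 := exp_one_lt_d9
  rw [h]
  constructor
  · calc (20 : ℝ) < 2.7182818283 ^ 3 := by norm_num
      _ < exp 1 ^ 3 := by gcongr
  · calc exp 1 ^ 3 < 2.7182818286 ^ 3 := by gcongr
      _ < 20.1 := by norm_num

lemma radialBoundary_le {n : ℝ} (hn : 0 < n) :
    8 * n * radialBoundary n ≤ exp (3 * n) ^ 3 := by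
  have h : 8 * n * radialBoundary n = 2 * (sinh (9 * n) - (1 + 2 * exp 3) * sinh (3 * n)) := by
    unfold radialBoundary; field_simp; ring
  have h9 : 2 * sinh (9 * n) = exp (3 * n) ^ 3 - exp (-(9 * n)) := by
    rw [sinh_eq, ← exp_nat_mul]; push_cast; ring_nf
  have hs : 0 ≤ sinh (3 * n) := sinh_nonneg_iff.2 (by positivity)
  have : 0 ≤ (1 + 2 * exp 3) * sinh (3 * n) := by positivity
  have := exp_pos (-(9 * n))
  rw [h]; linarith

lemma le_radialBoundary {n : ℝ} (hn : 0 < n) :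
    exp (3 * n) ^ 3 - (1 + 2 * exp 3) * exp (3 * n) ≤ 8 * n * radialBoundary n := by
  have h : 8 * n * radialBoundary n = 2 * (sinh (9 * n) - (1 + 2 * exp 3) * sinh (3 * n)) := by
    unfold radialBoundary; field_simp; ring
  have h9 : 2 * sinh (9 * n) = exp (3 * n) ^ 3 - exp (-(9 * n)) := by
    rw [sinh_eq, ← exp_nat_mul]; push_cast; ring_nf
  have h3 : 2 * sinh (3 * n) = exp (3 * n) - exp (-(3 * n)) := by
    rw [sinh_eq]; ring
  have hle : exp (-(9 * n)) ≤ exp (-(3 * n)) := exp_le_exp.2 (by linarith)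
  have : exp (-(3 * n)) ≤ (1 + 2 * exp 3) * exp (-(3 * n)) := by
    nlinarith [exp_pos 3, exp_pos (-(3 * n))]
  have e : 2 * (sinh (9 * n) - (1 + 2 * exp 3) * sinh (3 * n)) =
      2 * sinh (9 * n) - (1 + 2 * exp 3) * (2 * sinh (3 * n)) := by ring
  rw [h, e, h9, h3]
  linarith

lemma radial_gap {k z : ℝ} (hk : 1 ≤ k) (hz : 20 * k ≤ z) :
    (z ^ 3 + (k + 1)) ^ 2 * (k * (k + 2)) <
      (z ^ 3 - 54 * z) * (z ^ 3 - 0.001 * z) * (k + 1) ^ 2 := by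
  have hz20' : 20 ≤ z := by linarith
  set m : ℝ := k + 1 with hm
  have hmz : m ≤ 0.1 * z := by linarith
  have hmz2 : m ^ 2 ≤ 0.01 * z ^ 2 := by nlinarith
  have h1 : (z ^ 3 + m) ^ 2 ≤ z ^ 2 * (z ^ 2 + 0.1) ^ 2 := by
    rw [← mul_pow]; gcongr; nlinarith
  have h2 : k * (k + 2) = m ^ 2 - 1 := by rw [hm]; ring
  rw [h2]
  have hw : 400 ≤ z ^ 2 := by nlinarith
  set w := z ^ 2 with hw'
  have hm1 : 4 ≤ m ^ 2 := by nlinarith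
  have h3 : (w + 0.1) ^ 2 * (m ^ 2 - 1) < (w - 54) * (w - 0.001) * m ^ 2 := by
    have e1 : w * m ^ 2 ≤ 0.01 * w ^ 2 := by nlinarith
    nlinarith
  calc (z ^ 3 + m) ^ 2 * (m ^ 2 - 1) ≤ (w * (w + 0.1) ^ 2) * (m ^ 2 - 1) := by
        gcongr; linarith
    _ = w * ((w + 0.1) ^ 2 * (m ^ 2 - 1)) := by ring
    _ < w * ((w - 54) * (w - 0.001) * m ^ 2) := by gcongr
    _ = _ := by rw [hw']; ring

lemma binary_form_pos {P Q R α β : ℝ} (hP : 0 < P) (hdet : Q ^ 2 < P * R) (h0 : α ≠ 0 ∨ β ≠ 0) :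
    0 < α ^ 2 * P + 2 * α * β * Q + β ^ 2 * R := by
  by_contra hcon
  push Not at hcon
  have hid : P * (α ^ 2 * P + 2 * α * β * Q + β ^ 2 * R) =
      (P * α + Q * β) ^ 2 + (P * R - Q ^ 2) * β ^ 2 := by ring
  have hle : P * (α ^ 2 * P + 2 * α * β * Q + β ^ 2 * R) ≤ 0 :=
    mul_nonpos_of_nonneg_of_nonpos hP.le hcon
  rw [hid] at hle
  have hd : 0 < P * R - Q ^ 2 := by linarith
  have hβ : β = 0 := by
    by_contra hβ
    have : 0 < (P * R - Q ^ 2) * β ^ 2 := by positivity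
    nlinarith [sq_nonneg (P * α + Q * β)]
  subst hβ
  have hα : α ≠ 0 := by simpa using h0
  have : 0 < (P * α) ^ 2 := by positivity
  nlinarith

set_option maxHeartbeats 1000000 in
lemma radial_form_pos (k : ℕ) (hk : 1 ≤ k) (c s : ℝ) (hc : |c| ≤ 29)
    (hs : s = radialBoundary 1 ∨ s = -radialBoundary 1) (α β : ℝ) (h0 : α ≠ 0 ∨ β ≠ 0) :
    0 < α ^ 2 * (radialBoundary k + c) + 2 * α * β * (radialBoundary (k + 1) + s)
      + β ^ 2 * (radialBoundary (k + 2) + c) := by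
  obtain ⟨hE1, hE2⟩ := exp_three_bounds
  set E := exp 3 with hE
  have hkR : (1 : ℝ) ≤ k := by exact_mod_cast hk
  set z := exp (3 * (k : ℝ)) with hz
  have hzE : z = E ^ k := by rw [hz, hE, ← exp_nat_mul]; ring_nf
  have hz20 : 20 * (k : ℝ) ≤ z := by
    have h1 : (20 : ℝ) ^ k ≤ z := by rw [hzE]; gcongr
    have h2 : ∀ j : ℕ, 1 ≤ j → 20 * (j : ℝ) ≤ 20 ^ j := by
      intro j hj
      induction j, hj using Nat.le_induction with
      | base => norm_num
      | succ j hj ih => push_cast; rw [pow_succ]; nlinarith [(by exact_mod_cast hj : (1 : ℝ) ≤ j)]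
    exact (h2 k hk).trans h1
  have hz2 : exp (3 * ((k : ℝ) + 2)) = E ^ 2 * z := by
    rw [hz, hE, ← exp_nat_mul, ← exp_add]; push_cast; ring_nf
  have hz1 : exp (3 * ((k : ℝ) + 1)) = E * z := by
    rw [hz, hE, ← exp_add]; ring_nf
  obtain ⟨hc1, hc2⟩ := abs_le.1 hc
  -- diagonal terms
  have hP : z ^ 3 - 54 * z ≤ 8 * k * (radialBoundary k + c) := by
    have := le_radialBoundary (n := (k : ℝ)) (by linarith)
    rw [← hz, ← hE] at this
    nlinarith
  have hR : E ^ 6 * (z ^ 3 - 0.001 * z) ≤ 8 * (k + 2) * (radialBoundary (k + 2) + c) := by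
    have := le_radialBoundary (n := (k : ℝ) + 2) (by linarith)
    rw [hz2, ← hE] at this
    have e1 : 8 * ((k : ℝ) + 2) * c ≥ - (2 * (E ^ 2 * z)) := by
      nlinarith [mul_pos (show 0 < E by linarith) (show 0 < z by linarith)]
    have e2 : 0.001 * E ^ 6 * z ≥ 54 * (E ^ 2 * z) := by
      have : E ^ 4 ≥ 20 ^ 4 := by gcongr
      have h3 : 0 ≤ E ^ 2 * z := by positivity
      nlinarith
    have e3 : (1 + 2 * E) * (E ^ 2 * z) ≤ 42 * (E ^ 2 * z) := by gcongr; linarith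
    nlinarith
  have hQ1 : 0 ≤ radialBoundary 1 ∧ 8 * radialBoundary 1 ≤ E ^ 3 := by
    have h1 := radialBoundary_le (n := 1) one_pos
    have h2 := le_radialBoundary (n := 1) one_pos
    simp only [mul_one, ← hE] at h1 h2
    refine ⟨?_, h1⟩
    nlinarith
  have hQ2 : 0 ≤ radialBoundary (k + 1) ∧
      8 * (k + 1) * radialBoundary (k + 1) ≤ E ^ 3 * z ^ 3 := by
    have h1 := radialBoundary_le (n := (k : ℝ) + 1) (by linarith)
    have h2 := le_radialBoundary (n := (k : ℝ) + 1) (by linarith)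
    rw [hz1] at h1 h2
    rw [← hE] at h2
    refine ⟨?_, by linarith [mul_pow E z 3]⟩
    have hEz : 400 ≤ E * z := by nlinarith
    have : 0 ≤ (E * z) ^ 3 - (1 + 2 * E) * (E * z) := by
      have : (1 + 2 * E) ≤ (E * z) ^ 2 := by nlinarith
      nlinarith
    by_contra hneg
    push Not at hneg
    nlinarith
  have hQ : (8 * (k + 1) * (radialBoundary (k + 1) + s)) ^ 2 ≤ (E ^ 3 * (z ^ 3 + (k + 1))) ^ 2 := by
    obtain ⟨q1, q2⟩ := hQ1
    obtain ⟨q3, q4⟩ := hQ2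
    have q5 : (k + 1) * (8 * radialBoundary 1) ≤ (k + 1) * E ^ 3 := by gcongr
    have q6 : 0 ≤ (k + 1) * radialBoundary 1 := by positivity
    have q7 : 0 ≤ (k + 1) * radialBoundary (k + 1) := by positivity
    apply sq_le_sq'
    · rcases hs with rfl | rfl <;> linarith
    · rcases hs with rfl | rfl <;> linarith
  set P := radialBoundary k + c
  set R := radialBoundary (k + 2) + c
  set Q := radialBoundary (k + 1) + s
  have hz20' : 20 ≤ z := by linarith
  have hzsq : 400 ≤ z ^ 2 := by nlinarith
  have a1 : 0 < z ^ 3 - 54 * z := by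
    have : 0 < z * (z ^ 2 - 54) := mul_pos (by linarith) (by linarith)
    linarith
  have a2 : 0 < z ^ 3 - 0.001 * z := by linarith
  have hPpos : 0 < P := by
    by_contra h
    push Not at h
    nlinarith
  have key := radial_gap hkR hz20
  have hdet : Q ^ 2 < P * R := by
    have hkk : (0 : ℝ) < k := by linarith
    have b1 : (z ^ 3 - 54 * z) * (E ^ 6 * (z ^ 3 - 0.001 * z)) ≤
        (8 * k * P) * (8 * (k + 2) * R) := by gcongr
    have b2 : (8 * (k + 1) * Q) ^ 2 * (k * (k + 2)) <
        (8 * k * P) * (8 * (k + 2) * R) * (k + 1) ^ 2 := by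
      calc (8 * (k + 1) * Q) ^ 2 * (k * (k + 2))
          ≤ (E ^ 3 * (z ^ 3 + (k + 1))) ^ 2 * (k * (k + 2)) := by gcongr
        _ = E ^ 6 * ((z ^ 3 + (k + 1)) ^ 2 * (k * (k + 2))) := by ring
        _ < E ^ 6 * ((z ^ 3 - 54 * z) * (z ^ 3 - 0.001 * z) * (k + 1) ^ 2) := by gcongr
        _ = (z ^ 3 - 54 * z) * (E ^ 6 * (z ^ 3 - 0.001 * z)) * (k + 1) ^ 2 := by ring
        _ ≤ _ := by gcongr
    have b3 : (64 * (k + 1) ^ 2 * (k * (k + 2))) * Q ^ 2 <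
        (64 * (k + 1) ^ 2 * (k * (k + 2))) * (P * R) := by nlinarith
    exact lt_of_mul_lt_mul_left b3 (by positivity)
  exact binary_form_pos hPpos hdet h0

lemma two_mul_integral_cosh_lt (k : ℕ) (hk : 1 ≤ k) (α β : ℝ) (h0 : α ≠ 0 ∨ β ≠ 0) :
    2 * exp 3 * ∫ t in (0 : ℝ)..(3 / 2), (α * cosh (k * t) + β * cosh ((k + 2) * t)) ^ 2 <
      ∫ t in (3 / 2 : ℝ)..(9 / 2), (α * cosh (k * t) + β * cosh ((k + 2) * t)) ^ 2 := by
  have hkR : (0 : ℝ) < k := by exact_mod_cast hk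
  set W : ℝ → ℝ := fun t => α ^ 2 * (t / 2 + sinh (2 * k * t) / (4 * k)) +
    2 * α * β * (sinh (2 * (k + 1) * t) / (4 * (k + 1)) + sinh (2 * t) / 4) +
    β ^ 2 * (t / 2 + sinh (2 * (k + 2) * t) / (4 * (k + 2))) with hW
  have hd (n t : ℝ) : HasDerivAt (fun t => sinh (2 * n * t)) (cosh (2 * n * t) * (2 * n)) t := by
    simpa using (((hasDerivAt_id t).const_mul (2 * n)).sinh)
  have hder (t : ℝ) : HasDerivAt W ((α * cosh (k * t) + β * cosh ((k + 2) * t)) ^ 2) t := by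
    have h1 := hd k t
    have h2 := hd (k + 1) t
    have h3 := hd (k + 2) t
    have h4 := hd 1 t
    simp only [mul_one] at h4
    have h := ((((hasDerivAt_id t).div_const 2).add (h1.div_const (4 * k))).const_mul (α ^ 2)).add
      (((h2.div_const (4 * (k + 1))).add (h4.div_const 4)).const_mul (2 * α * β)) |>.add
      ((((hasDerivAt_id t).div_const 2).add (h3.div_const (4 * (k + 2)))).const_mul (β ^ 2))
    refine h.congr_deriv ?_
    have e1 : cosh (2 * k * t) = 2 * cosh (k * t) ^ 2 - 1 := by
      rw [mul_assoc, cosh_two_mul, sinh_sq]; ring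
    have e3 : cosh (2 * (k + 2) * t) = 2 * cosh ((k + 2) * t) ^ 2 - 1 := by
      rw [mul_assoc, cosh_two_mul, sinh_sq]; ring
    have e2 : cosh (2 * (k + 1) * t) + cosh (2 * t) = 2 * cosh (k * t) * cosh ((k + 2) * t) := by
      rw [show 2 * ((k : ℝ) + 1) * t = (k + 2) * t + k * t by ring,
        show 2 * t = (k + 2) * t - k * t by ring, cosh_add, cosh_sub]; ring
    have e2' : cosh (2 * (k + 1) * t) = 2 * cosh (k * t) * cosh ((k + 2) * t) - cosh (2 * t) := by
      linarith
    rw [e1, e3, e2']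
    field_simp
    ring
  have hcont : Continuous fun t : ℝ => (α * cosh (k * t) + β * cosh ((k + 2) * t)) ^ 2 := by
    fun_prop
  rw [intervalIntegral.integral_eq_sub_of_hasDerivAt (fun t _ => hder t)
    (hcont.intervalIntegrable _ _),
    intervalIntegral.integral_eq_sub_of_hasDerivAt (fun t _ => hder t)
    (hcont.intervalIntegrable _ _)]
  have hpos := radial_form_pos k hk (3 / 2 * (1 - exp 3)) (radialBoundary 1)
    (by obtain ⟨h1, h2⟩ := exp_three_bounds; rw [abs_le]; constructor <;> linarith)
    (Or.inl rfl) α β h0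
  have hid : W (9 / 2) - W (3 / 2) - 2 * exp 3 * (W (3 / 2) - W 0) =
      α ^ 2 * (radialBoundary k + 3 / 2 * (1 - exp 3)) +
      2 * α * β * (radialBoundary (k + 1) + radialBoundary 1)
      + β ^ 2 * (radialBoundary (k + 2) + 3 / 2 * (1 - exp 3)) := by
    simp only [hW, radialBoundary]
    rw [show 2 * (k : ℝ) * (9 / 2) = 9 * k by ring, show 2 * (k : ℝ) * (3 / 2) = 3 * k by ring,
      show 2 * ((k : ℝ) + 1) * (9 / 2) = 9 * (k + 1) by ring,
      show 2 * ((k : ℝ) + 1) * (3 / 2) = 3 * (k + 1) by ring,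
      show 2 * ((k : ℝ) + 2) * (9 / 2) = 9 * (k + 2) by ring,
      show 2 * ((k : ℝ) + 2) * (3 / 2) = 3 * (k + 2) by ring]
    norm_num
    ring
  linarith

lemma two_mul_integral_sinh_lt (k : ℕ) (hk : 1 ≤ k) (α β : ℝ) (h0 : α ≠ 0 ∨ β ≠ 0) :
    2 * exp 3 * ∫ t in (0 : ℝ)..(3 / 2), (α * sinh (k * t) + β * sinh ((k + 2) * t)) ^ 2 <
      ∫ t in (3 / 2 : ℝ)..(9 / 2), (α * sinh (k * t) + β * sinh ((k + 2) * t)) ^ 2 := by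
  have hkR : (0 : ℝ) < k := by exact_mod_cast hk
  set W : ℝ → ℝ := fun t => α ^ 2 * (-(t / 2) + sinh (2 * k * t) / (4 * k)) +
    2 * α * β * (sinh (2 * (k + 1) * t) / (4 * (k + 1)) - sinh (2 * t) / 4) +
    β ^ 2 * (-(t / 2) + sinh (2 * (k + 2) * t) / (4 * (k + 2))) with hW
  have hd (n t : ℝ) : HasDerivAt (fun t => sinh (2 * n * t)) (cosh (2 * n * t) * (2 * n)) t := by
    simpa using (((hasDerivAt_id t).const_mul (2 * n)).sinh)
  have hder (t : ℝ) : HasDerivAt W ((α * sinh (k * t) + β * sinh ((k + 2) * t)) ^ 2) t := by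
    have h1 := hd k t
    have h2 := hd (k + 1) t
    have h3 := hd (k + 2) t
    have h4 := hd 1 t
    simp only [mul_one] at h4
    have h := (((((hasDerivAt_id t).div_const 2).neg).add
        (h1.div_const (4 * k))).const_mul (α ^ 2)).add
      (((h2.div_const (4 * (k + 1))).sub (h4.div_const 4)).const_mul (2 * α * β)) |>.add
      (((((hasDerivAt_id t).div_const 2).neg).add (h3.div_const (4 * (k + 2)))).const_mul (β ^ 2))
    refine h.congr_deriv ?_
    have e1 : cosh (2 * k * t) = 2 * sinh (k * t) ^ 2 + 1 := by
      rw [mul_assoc, cosh_two_mul, cosh_sq]; ring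
    have e3 : cosh (2 * (k + 2) * t) = 2 * sinh ((k + 2) * t) ^ 2 + 1 := by
      rw [mul_assoc, cosh_two_mul, cosh_sq]; ring
    have e2 : cosh (2 * (k + 1) * t) - cosh (2 * t) = 2 * sinh (k * t) * sinh ((k + 2) * t) := by
      rw [show 2 * ((k : ℝ) + 1) * t = (k + 2) * t + k * t by ring,
        show 2 * t = (k + 2) * t - k * t by ring, cosh_add, cosh_sub]; ring
    have e2' : cosh (2 * (k + 1) * t) = 2 * sinh (k * t) * sinh ((k + 2) * t) + cosh (2 * t) := by
      linarith
    rw [e1, e3, e2']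
    field_simp
    ring
  have hcont : Continuous fun t : ℝ => (α * sinh (k * t) + β * sinh ((k + 2) * t)) ^ 2 := by
    fun_prop
  rw [intervalIntegral.integral_eq_sub_of_hasDerivAt (fun t _ => hder t)
    (hcont.intervalIntegrable _ _),
    intervalIntegral.integral_eq_sub_of_hasDerivAt (fun t _ => hder t)
    (hcont.intervalIntegrable _ _)]
  have hpos := radial_form_pos k hk (-(3 / 2 * (1 - exp 3))) (-radialBoundary 1)
    (by obtain ⟨h1, h2⟩ := exp_three_bounds; rw [abs_le]; constructor <;> linarith)
    (Or.inr rfl) α β h0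
  have hid : W (9 / 2) - W (3 / 2) - 2 * exp 3 * (W (3 / 2) - W 0) =
      α ^ 2 * (radialBoundary k + -(3 / 2 * (1 - exp 3))) +
      2 * α * β * (radialBoundary (k + 1) + -radialBoundary 1)
      + β ^ 2 * (radialBoundary (k + 2) + -(3 / 2 * (1 - exp 3))) := by
    simp only [hW, radialBoundary]
    rw [show 2 * (k : ℝ) * (9 / 2) = 9 * k by ring, show 2 * (k : ℝ) * (3 / 2) = 3 * k by ring,
      show 2 * ((k : ℝ) + 1) * (9 / 2) = 9 * (k + 1) by ring,
      show 2 * ((k : ℝ) + 1) * (3 / 2) = 3 * (k + 1) by ring,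
      show 2 * ((k : ℝ) + 2) * (9 / 2) = 9 * (k + 2) by ring,
      show 2 * ((k : ℝ) + 2) * (3 / 2) = 3 * (k + 2) by ring]
    norm_num
    ring
  linarith

lemma cosh_sinh_three_intervals (k : ℕ) (hk : 1 ≤ k) (α β γ δ : ℝ) (g : ℝ → ℝ)
    (hg : ∀ t, g t = (α * cosh (k * t) + β * cosh ((k + 2) * t)) +
      (γ * sinh (k * t) + δ * sinh ((k + 2) * t)))
    (h0 : (α ≠ 0 ∨ β ≠ 0) ∨ (γ ≠ 0 ∨ δ ≠ 0)) :
    2 * exp 3 * ∫ t in (-(3 / 2) : ℝ)..(3 / 2), g t ^ 2 <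
      (∫ t in (3 / 2 : ℝ)..(9 / 2), g t ^ 2) + ∫ t in (-(9 / 2) : ℝ)..(-(3 / 2)), g t ^ 2 := by
  set U : ℝ → ℝ := fun t => α * cosh (k * t) + β * cosh ((k + 2) * t) with hU
  set V : ℝ → ℝ := fun t => γ * sinh (k * t) + δ * sinh ((k + 2) * t) with hV
  have hUc : Continuous U := by fun_prop
  have hVc : Continuous V := by fun_prop
  have hgUV : g = fun t => U t + V t := funext hg
  have hgc : Continuous g := by rw [hgUV]; fun_prop
  have hgn (t : ℝ) : g (-t) = U t - V t := by
    rw [hgUV]; simp only [hU, hV, mul_neg, cosh_neg, sinh_neg]; ring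
  have hsum (a b : ℝ) : (∫ t in a..b, g t ^ 2) + (∫ t in (-b)..(-a), g t ^ 2) =
      2 * ((∫ t in a..b, U t ^ 2) + ∫ t in a..b, V t ^ 2) := by
    rw [← intervalIntegral.integral_comp_neg (fun t => g t ^ 2),
      ← intervalIntegral.integral_add, ← intervalIntegral.integral_add,
      ← intervalIntegral.integral_const_mul]
    · refine intervalIntegral.integral_congr fun t _ => ?_
      simp only [hgn]
      rw [hgUV]; ring
    all_goals exact Continuous.intervalIntegrable (by fun_prop) _ _
  have hin : ∫ t in (-(3 / 2) : ℝ)..(3 / 2), g t ^ 2 =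
      (∫ t in (0 : ℝ)..(3 / 2), g t ^ 2) + ∫ t in (-(3 / 2) : ℝ)..(-0), g t ^ 2 := by
    rw [neg_zero, add_comm, intervalIntegral.integral_add_adjacent_intervals]
    all_goals exact Continuous.intervalIntegrable (by fun_prop) _ _
  rw [hin, hsum, hsum]
  have hUlt := two_mul_integral_cosh_lt k hk α β
  have hVlt := two_mul_integral_sinh_lt k hk γ δ
  have hUle : 2 * exp 3 * ∫ t in (0 : ℝ)..(3 / 2), U t ^ 2 ≤
      ∫ t in (3 / 2 : ℝ)..(9 / 2), U t ^ 2 := by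
    by_cases h : α ≠ 0 ∨ β ≠ 0
    · exact (hUlt h).le
    · push Not at h
      simp [hU, h.1, h.2]
  have hVle : 2 * exp 3 * ∫ t in (0 : ℝ)..(3 / 2), V t ^ 2 ≤
      ∫ t in (3 / 2 : ℝ)..(9 / 2), V t ^ 2 := by
    by_cases h : γ ≠ 0 ∨ δ ≠ 0
    · exact (hVlt h).le
    · push Not at h
      simp [hV, h.1, h.2]
  rcases h0 with h | h
  · have := hUlt h
    simp only [hU, hV] at *
    linarith
  · have := hVlt h
    simp only [hU, hV] at *
    linarith

lemma exp_sum_three_intervals (k : ℕ) (hk : 1 ≤ k) (c₁ c₂ c₃ c₄ τ : ℝ) (u : ℝ → ℝ)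
    (hu : ∀ t ∈ Set.Ioo (τ - 9 / 2) (τ + 9 / 2), u t = c₁ * exp (k * t) + c₂ * exp (-(k * t)) +
      c₃ * exp ((k + 2) * t) + c₄ * exp (-((k + 2) * t)))
    (h0 : ∃ t ∈ Set.Ioo (τ - 9 / 2) (τ + 9 / 2), u t ≠ 0) :
    2 * ∫ t in (τ - 3 / 2)..(τ + 3 / 2), u t ^ 2 <
      exp (-3) * ((∫ t in (τ + 3 / 2)..(τ + 9 / 2), u t ^ 2) +
        ∫ t in (τ - 9 / 2)..(τ - 3 / 2), u t ^ 2) := by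
  set d₁ := c₁ * exp (k * τ)
  set d₂ := c₂ * exp (-(k * τ))
  set d₃ := c₃ * exp ((k + 2) * τ)
  set d₄ := c₄ * exp (-((k + 2) * τ))
  set g : ℝ → ℝ := fun t => ((d₁ + d₂) * cosh (k * t) + (d₃ + d₄) * cosh ((k + 2) * t)) +
      ((d₁ - d₂) * sinh (k * t) + (d₃ - d₄) * sinh ((k + 2) * t)) with hg
  have hug : ∀ t ∈ Set.Ioo (-(9 / 2) : ℝ) (9 / 2), u (τ + t) = g t := by
    intro t ht
    rw [hu (τ + t) ⟨by linarith [ht.1], by linarith [ht.2]⟩, hg]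
    simp only [cosh_eq, sinh_eq, d₁, d₂, d₃, d₄]
    rw [show (k : ℝ) * (τ + t) = k * τ + k * t by ring,
      show ((k : ℝ) + 2) * (τ + t) = (k + 2) * τ + (k + 2) * t by ring]
    simp only [neg_add, exp_add]
    ring
  have hInt (a b : ℝ) (ha : -(9 / 2) ≤ a) (hab : a ≤ b) (hb : b ≤ 9 / 2) :
      ∫ t in (τ + a)..(τ + b), u t ^ 2 = ∫ t in a..b, g t ^ 2 := by
    rw [← intervalIntegral.integral_comp_add_left (fun t => u t ^ 2) τ,
      intervalIntegral.integral_of_le hab, intervalIntegral.integral_of_le hab,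
      integral_Ioc_eq_integral_Ioo, integral_Ioc_eq_integral_Ioo]
    refine setIntegral_congr_fun measurableSet_Ioo fun t ht => ?_
    rw [hug t ⟨by linarith [ht.1], by linarith [ht.2]⟩]
  have hmain := cosh_sinh_three_intervals k hk _ _ _ _ g (fun _ => rfl) (by
    by_contra hcon
    push Not at hcon
    obtain ⟨⟨h1, h2⟩, h3, h4⟩ := hcon
    obtain ⟨t, ht, hne⟩ := h0
    apply hne
    have := hug (t - τ) ⟨by linarith [ht.1], by linarith [ht.2]⟩
    rw [show τ + (t - τ) = t by ring] at this
    rw [this, hg]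
    simp [h1, h2, h3, h4])
  rw [sub_eq_add_neg, sub_eq_add_neg τ (9 / 2), hInt _ _ (by norm_num) (by norm_num) (by norm_num),
    hInt _ _ (by norm_num) (by norm_num) (by norm_num),
    hInt _ _ (by norm_num) (by norm_num) (by norm_num)]
  have h3 : exp (-3) * exp 3 = 1 := by rw [← exp_add]; simp
  have := mul_lt_mul_of_pos_left hmain (exp_pos (-3))
  calc _ = exp (-3) * exp 3 * (2 * ∫ t in (-(3 / 2) : ℝ)..(3 / 2), g t ^ 2) := by rw [h3, one_mul]
    _ = exp (-3) * (2 * exp 3 * ∫ t in (-(3 / 2) : ℝ)..(3 / 2), g t ^ 2) := by ring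
    _ < _ := this

end OneDim

section EulerODE

open Real

lemma exists_const_of_hasDerivAt_zero {a b : ℝ} {w : ℝ → ℝ}
    (hw : ∀ t ∈ Set.Ioo a b, HasDerivAt w 0 t) : ∃ c, ∀ t ∈ Set.Ioo a b, w t = c := by
  rcases (Set.Ioo a b).eq_empty_or_nonempty with h | ⟨s, hs⟩
  · exact ⟨0, by simp [h]⟩
  · refine ⟨w s, fun t ht => ?_⟩
    exact isOpen_Ioo.is_const_of_deriv_eq_zero isPreconnected_Ioo
      (fun x hx => (hw x hx).differentiableAt.differentiableWithinAt)
      (fun x hx => (hw x hx).deriv) ht hs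

lemma exp_sum_of_second_order {a b : ℝ} {k : ℕ} {u u₁ u₂ : ℝ → ℝ}
    (hu : ∀ t ∈ Set.Ioo a b, HasDerivAt u (u₁ t) t)
    (hu₁ : ∀ t ∈ Set.Ioo a b, HasDerivAt u₁ (u₂ t) t)
    (hode : ∀ t ∈ Set.Ioo a b, u₂ t + 2 * u₁ t - k * (k + 2) * u t = 0) :
    ∃ c d : ℝ, ∀ t ∈ Set.Ioo a b, u t = c * exp (k * t) + d * exp (-((k + 2) * t)) := by
  have hexp (n t : ℝ) : HasDerivAt (fun t => exp (n * t)) (exp (n * t) * n) t := by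
    simpa using ((hasDerivAt_id t).const_mul n).exp
  obtain ⟨p, hp⟩ := exists_const_of_hasDerivAt_zero (a := a) (b := b)
    (w := fun t => (u₁ t - k * u t) * exp ((k + 2) * t)) (fun t ht => by
      refine (((hu₁ t ht).sub ((hu t ht).const_mul (k : ℝ))).mul (hexp (k + 2) t)).congr_deriv ?_
      simp only [Pi.sub_apply]
      linear_combination exp ((k + 2) * t) * hode t ht)
  obtain ⟨q, hq⟩ := exists_const_of_hasDerivAt_zero (a := a) (b := b)
    (w := fun t => (u₁ t + (k + 2) * u t) * exp (-k * t)) (fun t ht => by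
      refine (((hu₁ t ht).add ((hu t ht).const_mul ((k : ℝ) + 2))).mul
        (hexp (-k) t)).congr_deriv ?_
      simp only [Pi.add_apply]
      linear_combination exp (-k * t) * hode t ht)
  refine ⟨q / (2 * k + 2), -p / (2 * k + 2), fun t ht => ?_⟩
  have e1 : exp ((k + 2) * t) * exp (-((k + 2) * t)) = 1 := by rw [← exp_add]; simp
  have e2 : exp (-k * t) * exp (k * t) = 1 := by rw [← exp_add]; simp
  have h1 : u₁ t - k * u t = p * exp (-((k + 2) * t)) := by
    rw [← hp t ht, mul_assoc, e1, mul_one]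
  have h2 : u₁ t + (k + 2) * u t = q * exp (k * t) := by
    rw [← hq t ht, mul_assoc, e2, mul_one]
  have h3 : (2 * (k : ℝ) + 2) ≠ 0 := by positivity
  have h4 : u t * (2 * k + 2) = q * exp (k * t) - p * exp (-((k + 2) * t)) := by
    linear_combination h2 - h1
  rw [eq_div_of_mul_eq h3 h4]
  ring

lemma exp_sum_of_fourth_order {a b : ℝ} {k : ℕ} (hk : 1 ≤ k) {u u₁ u₂ v v₁ v₂ : ℝ → ℝ}
    (hu : ∀ t ∈ Set.Ioo a b, HasDerivAt u (u₁ t) t)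
    (hu₁ : ∀ t ∈ Set.Ioo a b, HasDerivAt u₁ (u₂ t) t)
    (hv : ∀ t ∈ Set.Ioo a b, HasDerivAt v (v₁ t) t)
    (hv₁ : ∀ t ∈ Set.Ioo a b, HasDerivAt v₁ (v₂ t) t)
    (huv : ∀ t ∈ Set.Ioo a b, u₂ t + 2 * u₁ t - k * (k + 2) * u t = exp (2 * t) * v t)
    (hode : ∀ t ∈ Set.Ioo a b, v₂ t + 2 * v₁ t - k * (k + 2) * v t = 0) :
    ∃ c₁ c₂ c₃ c₄ : ℝ, ∀ t ∈ Set.Ioo a b, u t = c₁ * exp (k * t) + c₂ * exp (-(k * t)) +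
      c₃ * exp ((k + 2) * t) + c₄ * exp (-((k + 2) * t)) := by
  obtain ⟨c, d, hcd⟩ := exp_sum_of_second_order hv hv₁ hode
  have hkR : (0 : ℝ) < k := by exact_mod_cast hk
  have hexp (n t : ℝ) : HasDerivAt (fun t => exp (n * t)) (exp (n * t) * n) t := by
    simpa using ((hasDerivAt_id t).const_mul n).exp
  set A : ℝ := c / (4 * (k + 2)) with hA
  set B : ℝ := -d / (4 * k) with hB
  obtain ⟨p, q, hpq⟩ := exp_sum_of_second_order (a := a) (b := b) (k := k)
    (u := fun t => u t - (A * exp ((k + 2) * t) + B * exp (-k * t)))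
    (u₁ := fun t => u₁ t - (A * (exp ((k + 2) * t) * (k + 2)) + B * (exp (-k * t) * -k)))
    (u₂ := fun t => u₂ t - (A * (exp ((k + 2) * t) * (k + 2) * (k + 2)) +
      B * (exp (-k * t) * -k * -k)))
    (fun t ht => (hu t ht).sub (((hexp (k + 2) t).const_mul A).add ((hexp (-k) t).const_mul B)))
    (fun t ht => (hu₁ t ht).sub ((((hexp (k + 2) t).mul_const (k + 2 : ℝ)).const_mul A).add
      (((hexp (-k) t).mul_const (-k : ℝ)).const_mul B)))
    (fun t ht => by
      have h := huv t ht
      rw [hcd t ht] at h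
      have e1 : exp (2 * t) * exp (k * t) = exp ((k + 2) * t) := by rw [← exp_add]; ring_nf
      have e2 : exp (2 * t) * exp (-((k + 2) * t)) = exp (-k * t) := by rw [← exp_add]; ring_nf
      have h' : u₂ t + 2 * u₁ t - k * (k + 2) * u t =
          c * exp ((k + 2) * t) + d * exp (-k * t) := by
        rw [h, ← e1, ← e2]; ring
      have hA' : c = A * (4 * (k + 2)) := by rw [hA]; field_simp
      have hB' : d = -(B * (4 * k)) := by rw [hB]; field_simp
      rw [hA', hB'] at h'
      linear_combination h')
  refine ⟨p, B, A, q, fun t ht => ?_⟩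
  have := hpq t ht
  rw [neg_mul] at this
  linear_combination this

end EulerODE

section Uniqueness

lemma integral_eq_zero_of_transitive_isometries {X : Type*} [MetricSpace X] [CompactSpace X]
    [MeasurableSpace X] [BorelSpace X] (μ ν : Measure X) [IsFiniteMeasure μ] [IsFiniteMeasure ν]
    (hν : ν ≠ 0)
    (hT : ∀ x y : X, ∃ T : X ≃ᵢ X, T x = y ∧ MeasurePreserving T μ μ ∧ MeasurePreserving T ν ν)
    {F : X → ℝ} (hF : Continuous F) (h0 : ∫ x, F x ∂ν = 0) : ∫ x, F x ∂μ = 0 := by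
  have int_of_cont : ∀ (m : Measure X) [IsFiniteMeasure m] {g : X → ℝ}, Continuous g →
      Integrable g m := fun m _ g hg =>
    hg.integrable_of_hasCompactSupport (HasCompactSupport.of_compactSpace g)
  have hXne : Nonempty X := by
    by_contra h
    rw [not_nonempty_iff] at h
    exact hν (Measure.eq_zero_of_isEmpty ν)
  obtain ⟨x₀⟩ := hXne
  suffices H : ∀ δ > 0, |∫ x, F x ∂μ| ≤ δ * μ.real Set.univ by
    have : |∫ x, F x ∂μ| ≤ 0 := by
      refine le_of_forall_pos_le_add fun η hη => ?_
      have hm : 0 ≤ μ.real Set.univ := measureReal_nonneg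
      refine (H (η / (μ.real Set.univ + 1)) (by positivity)).trans ?_
      rw [zero_add, div_mul_eq_mul_div, div_le_iff₀ (by positivity)]
      nlinarith
    exact abs_nonpos_iff.1 this
  intro δ hδ
  obtain ⟨ε, hε, hFε⟩ := Metric.uniformContinuous_iff.1
    (CompactSpace.uniformContinuous_of_continuous hF) δ hδ
  set k : X → X → ℝ := fun x y => max 0 (ε - dist x y) with hk
  have hkc : Continuous fun p : X × X => k p.1 p.2 := by
    simp only [hk]; fun_prop
  have hk0 : ∀ x y, 0 ≤ k x y := fun x y => le_max_left _ _
  have hksymm : ∀ x y, k x y = k y x := fun x y => by simp only [hk, dist_comm]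
  have hkT : ∀ (T : X ≃ᵢ X) x y, k (T x) (T y) = k x y := fun T x y => by
    simp only [hk, T.dist_eq]
  have hconst : ∀ (m : Measure X), (∀ x y : X, ∃ T : X ≃ᵢ X, T x = y ∧ MeasurePreserving T m m) →
      ∀ x, ∫ y, k x y ∂m = ∫ y, k x₀ y ∂m := by
    intro m hm x
    obtain ⟨T, rfl, hTm⟩ := hm x₀ x
    rw [← hTm.integral_comp T.toHomeomorph.measurableEmbedding]
    simp only [hkT]
  have hcμ := hconst μ fun x y => (hT x y).imp fun T h => ⟨h.1, h.2.1⟩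
  have hcν := hconst ν fun x y => (hT x y).imp fun T h => ⟨h.1, h.2.2⟩
  set a := ∫ y, k x₀ y ∂μ
  set b := ∫ y, k x₀ y ∂ν
  have hkx : ∀ x, Continuous (k x) := fun x => hkc.comp (by fun_prop : Continuous fun y => (x, y))
  have hky : ∀ y, Continuous (fun x => k x y) :=
    fun y => hkc.comp (by fun_prop : Continuous fun x => (x, y))
  have hb : 0 < b := by
    refine lt_of_le_of_ne (integral_nonneg (hk0 x₀)) fun hb => ?_
    have hball : ∀ x, ν (ball x ε) = 0 := by
      intro x
      have h1 : ∫ y, k x y ∂ν = 0 := (hcν x).trans hb.symm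
      rw [integral_eq_zero_iff_of_nonneg (hk0 x) (int_of_cont ν (hkx x))] at h1
      refine measure_mono_null (fun y hy => ?_) h1
      have : dist x y < ε := by rw [dist_comm]; exact hy
      simp only [hk, Set.mem_ofPred_eq, Set.mem_compl_iff, Pi.zero_apply]
      exact (lt_max_of_lt_right (by linarith)).ne'
    refine hν (Measure.measure_univ_eq_zero.1 ?_)
    exact isCompact_univ.measure_zero_of_nhdsWithin fun x _ =>
      ⟨ball x ε, mem_nhdsWithin_of_mem_nhds (ball_mem_nhds x hε), hball x⟩
  have hFk : Continuous fun p : X × X => F p.1 * k p.1 p.2 := by fun_prop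
  have hInt : Integrable (fun p : X × X => F p.1 * k p.1 p.2) (ν.prod μ) :=
    hFk.integrable_of_hasCompactSupport (HasCompactSupport.of_compactSpace _)
  have hswap : ∫ y, ∫ x, F x * k x y ∂ν ∂μ = 0 := by
    rw [← integral_integral_swap (f := fun x y => F x * k x y) hInt]
    simp only [integral_const_mul, hcμ, integral_mul_const, h0, zero_mul]
  have hdiff : ∀ y, |(∫ x, F x * k x y ∂ν) - F y * b| ≤ δ * b := by
    intro y
    have hb' : b = ∫ x, k x y ∂ν := by
      rw [← hcν y]; simp only [hksymm y]
    have c1 : Continuous fun x => F x * k x y := hF.mul (hky y)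
    have c2 : Continuous fun x => F y * k x y := continuous_const.mul (hky y)
    rw [hb', ← integral_const_mul, ← integral_const_mul, ← integral_sub
      (int_of_cont ν c1) (int_of_cont ν c2)]
    refine (abs_integral_le_integral_abs).trans (integral_mono (int_of_cont ν ?_)
      (int_of_cont ν (continuous_const.mul (hky y))) fun x => ?_)
    · exact (c1.sub c2).abs
    · simp only
      rw [← sub_mul, abs_mul, abs_of_nonneg (hk0 x y)]
      by_cases hxy : dist x y < ε
      · exact mul_le_mul_of_nonneg_right (by simpa [Real.dist_eq] using (hFε hxy).le) (hk0 x y)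
      · have : k x y = 0 := max_eq_left (by linarith)
        simp [this]
  have hgint : Integrable (fun y => ∫ x, F x * k x y ∂ν) μ := hInt.integral_prod_right
  have key : |∫ y, F y * b ∂μ| ≤ δ * b * μ.real Set.univ := by
    have c1 : Continuous fun y => F y * b := hF.mul continuous_const
    have h1 : ∫ y, ((∫ x, F x * k x y ∂ν) - F y * b) ∂μ = - ∫ y, F y * b ∂μ := by
      rw [integral_sub hgint (int_of_cont μ c1), hswap, zero_sub]
    rw [← abs_neg, ← h1]
    have := norm_integral_le_of_norm_le_const (μ := μ)
      (f := fun y => (∫ x, F x * k x y ∂ν) - F y * b) (C := δ * b)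
      (Filter.Eventually.of_forall fun y => by simpa using hdiff y)
    simpa using this
  rw [integral_mul_const, abs_mul, abs_of_pos hb] at key
  have : b * (|∫ x, F x ∂μ|) ≤ b * (δ * μ.real Set.univ) := by linarith
  exact le_of_mul_le_mul_left this hb

end Uniqueness

section SphereMeasure

/-- Euclidean four-space. -/
abbrev E4 := EuclideanSpace ℝ (Fin 4)

/-- The unit sphere of Euclidean four-space. -/
abbrev S3 := sphere (0 : E4) 1

/-- The surface measure of the unit sphere of Euclidean four-space. -/
def sphereMeasure : Measure S3 := (volume : Measure E4).toSphere

instance : IsFiniteMeasure sphereMeasure := by unfold sphereMeasure; infer_instance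

instance : sphereMeasure.IsOpenPosMeasure := by unfold sphereMeasure; infer_instance

/-- The isometry of the unit sphere induced by a linear isometry. -/
def sphereIsometry (e : E4 ≃ₗᵢ[ℝ] E4) : S3 ≃ᵢ S3 where
  toFun ω := ⟨e ω, by simp⟩
  invFun ω := ⟨e.symm ω, by simp⟩
  left_inv ω := by simp
  right_inv ω := by simp
  isometry_toFun := by
    intro x y
    rw [Subtype.edist_eq, Subtype.edist_eq]
    exact e.isometry.edist_eq _ _

@[simp] lemma coe_sphereIsometry (e : E4 ≃ₗᵢ[ℝ] E4) (ω : S3) :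
    (sphereIsometry e ω : E4) = e ω := rfl

lemma exists_sphereIsometry_apply_eq (x y : S3) : ∃ e : E4 ≃ₗᵢ[ℝ] E4, sphereIsometry e x = y := by
  refine ⟨(Submodule.span ℝ {(x : E4) - y})ᗮ.reflection, Subtype.ext ?_⟩
  rw [coe_sphereIsometry]
  exact Submodule.reflection_sub (by simp)

open scoped Pointwise in
lemma measurePreserving_sphereIsometry (e : E4 ≃ₗᵢ[ℝ] E4) :
    MeasurePreserving (sphereIsometry e) sphereMeasure sphereMeasure := by
  refine ⟨(sphereIsometry e).continuous.measurable, ?_⟩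
  ext s hs
  have hs' : MeasurableSet (sphereIsometry e ⁻¹' s) :=
    (sphereIsometry e).continuous.measurable hs
  rw [Measure.map_apply (sphereIsometry e).continuous.measurable hs, sphereMeasure,
    Measure.toSphere_apply' _ hs', Measure.toSphere_apply' _ hs]
  congr 1
  have : Set.Ioo (0 : ℝ) 1 • ((↑) '' (sphereIsometry e ⁻¹' s) : Set E4)
      = e ⁻¹' (Set.Ioo (0 : ℝ) 1 • ((↑) '' s : Set E4)) := by
    ext x
    simp only [Set.mem_smul, Set.mem_image, Set.mem_preimage]
    constructor
    · rintro ⟨r, hr, _, ⟨ω, hω, rfl⟩, rfl⟩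
      exact ⟨r, hr, _, ⟨_, hω, rfl⟩, by simp⟩
    · rintro ⟨r, hr, _, ⟨ω, hω, rfl⟩, h⟩
      refine ⟨r, hr, _, ⟨(sphereIsometry e).symm ω, by simpa using hω, rfl⟩, ?_⟩
      apply e.injective
      rw [← h, map_smul]
      congr 1
      exact e.apply_symm_apply _
  rw [this]
  exact e.measurePreserving.measure_preimage_equiv (f := e.toMeasurableEquiv) _

lemma hausdorffMeasure_sphere_lt_top : μH[3] (sphere (0 : E4) 1) < ⊤ := by
  let g : (Fin 3 → ℝ) → E4 := fun p => !₂[Real.cos (p 0) * Real.cos (p 1),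
    Real.cos (p 0) * Real.sin (p 1), Real.sin (p 0) * Real.cos (p 2),
    Real.sin (p 0) * Real.sin (p 2)]
  have hg : ContDiff ℝ 1 g := by
    rw [contDiff_euclidean]
    intro i
    fin_cases i <;> simp [g] <;> fun_prop
  obtain ⟨K, hK⟩ := LocallyLipschitzOn.exists_lipschitzOnWith_of_compact
    (isCompact_closedBall (0 : Fin 3 → ℝ) 4) (hg.locallyLipschitz.locallyLipschitzOn)
  have hsub : sphere (0 : E4) 1 ⊆ g '' closedBall 0 4 := by
    intro x hx
    have hx1 : x 0 ^ 2 + x 1 ^ 2 + x 2 ^ 2 + x 3 ^ 2 = 1 := by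
      have h : ‖x‖ = 1 := by simpa using hx
      have h2 := EuclideanSpace.real_norm_sq_eq x
      rw [h, Fin.sum_univ_four] at h2
      linarith
    set z : ℂ := ⟨x 0, x 1⟩ with hz
    set w : ℂ := ⟨x 2, x 3⟩ with hw
    have hz2 : ‖z‖ ^ 2 = x 0 ^ 2 + x 1 ^ 2 := by
      rw [Complex.sq_norm, Complex.normSq_mk]; ring
    have hw2 : ‖w‖ ^ 2 = x 2 ^ 2 + x 3 ^ 2 := by
      rw [Complex.sq_norm, Complex.normSq_mk]; ring
    have hzle : ‖z‖ ≤ 1 := by nlinarith [norm_nonneg z, norm_nonneg w, sq_nonneg ‖w‖]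
    have hc : Real.cos (Real.arccos ‖z‖) = ‖z‖ :=
      Real.cos_arccos (by linarith [norm_nonneg z]) hzle
    have hs : Real.sin (Real.arccos ‖z‖) = ‖w‖ := by
      rw [Real.sin_arccos, show 1 - ‖z‖ ^ 2 = ‖w‖ ^ 2 by linarith, Real.sqrt_sq (norm_nonneg w)]
    refine ⟨![Real.arccos ‖z‖, z.arg, w.arg], ?_, ?_⟩
    · rw [mem_closedBall_zero_iff, pi_norm_le_iff_of_nonneg (by norm_num)]
      have hpi := Real.pi_lt_d2
      intro i
      fin_cases i
      · simp only [Fin.zero_eta, Matrix.cons_val_zero, Real.norm_eq_abs]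
        rw [abs_of_nonneg (Real.arccos_nonneg _)]
        linarith [Real.arccos_le_pi ‖z‖]
      · simpa using (Complex.abs_arg_le_pi z).trans (by linarith)
      · simpa using (Complex.abs_arg_le_pi w).trans (by linarith)
    · ext i
      fin_cases i
      · simp [g, hc, Complex.norm_mul_cos_arg]; rfl
      · simp [g, hc, Complex.norm_mul_sin_arg]; rfl
      · simp [g, hs, Complex.norm_mul_cos_arg]; rfl
      · simp [g, hs, Complex.norm_mul_sin_arg]; rfl
  refine (measure_mono hsub).trans_lt ((hK.hausdorffMeasure_image_le (by norm_num)).trans_lt ?_)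
  refine ENNReal.mul_lt_top (ENNReal.rpow_lt_top_of_nonneg (by norm_num) (by simp)) ?_
  have h3 : (μH[3] : Measure (Fin 3 → ℝ)) = volume := by
    have := @hausdorffMeasure_pi_real (Fin 3) _
    simpa using this
  rw [h3]
  exact (isCompact_closedBall _ _).measure_lt_top

lemma hausdorffMeasure_sphere_ne_zero : μH[3] (sphere (0 : E4) 1) ≠ 0 := by
  let g : E4 → (Fin 3 → ℝ) := fun x i => x i.castSucc
  have hg : LipschitzWith 1 g := by
    refine LipschitzWith.of_dist_le_mul fun x y => ?_
    rw [NNReal.coe_one, one_mul, dist_pi_le_iff dist_nonneg]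
    intro i
    rw [dist_eq_norm x y, Real.dist_eq]
    exact PiLp.norm_apply_le (x - y) i.castSucc
  have hsub : closedBall (0 : Fin 3 → ℝ) (1 / 2) ⊆ g '' sphere (0 : E4) 1 := by
    intro p hp
    rw [mem_closedBall_zero_iff, pi_norm_le_iff_of_nonneg (by norm_num)] at hp
    have h i : p i ^ 2 ≤ 1 / 4 := by
      have := hp i
      rw [Real.norm_eq_abs] at this
      rw [← sq_abs]; nlinarith [abs_nonneg (p i)]
    refine ⟨!₂[p 0, p 1, p 2, √(1 - p 0 ^ 2 - p 1 ^ 2 - p 2 ^ 2)], ?_, ?_⟩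
    · rw [mem_sphere_zero_iff_norm, ← sq_eq_sq₀ (norm_nonneg _) zero_le_one,
        EuclideanSpace.real_norm_sq_eq, Fin.sum_univ_four]
      simp
      rw [Real.sq_sqrt (by linarith [h 0, h 1, h 2])]
      ring
    · ext i
      fin_cases i <;> simp [g]
  intro h0
  have h1 := (hg.hausdorffMeasure_image_le (d := 3) (by norm_num) (sphere (0 : E4) 1))
  rw [h0, mul_zero] at h1
  have h3 : (μH[3] : Measure (Fin 3 → ℝ)) = volume := by
    have := @hausdorffMeasure_pi_real (Fin 3) _
    simpa using this
  have h2 := (measure_mono hsub).trans h1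
  rw [h3, nonpos_iff_eq_zero] at h2
  have h4 := measure_mono_null ball_subset_closedBall h2
  exact (measure_ball_pos volume (0 : Fin 3 → ℝ) (by norm_num : (0 : ℝ) < 1 / 2)).ne' h4

lemma integral_sphere_comp_smul_eq_zero {r : ℝ} (hr : 0 < r) {f : E4 → ℝ}
    (hf : ContinuousOn f (sphere 0 r))
    (h : ∫ x in sphere (0 : E4) r, f x ∂(μH[3]) = 0) :
    ∫ ω : S3, f (r • (ω : E4)) ∂sphereMeasure = 0 := by
  have hmap : Measure.map (fun ω : S3 => (ω : E4)) μH[3] = μH[3].restrict (sphere (0 : E4) 1) := by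
    rw [isometry_subtype_coe.map_hausdorffMeasure (Or.inl (by norm_num)), Subtype.range_coe]
  have huniv : (μH[3] : Measure S3) Set.univ = μH[3] (sphere (0 : E4) 1) := by
    have := congrArg (fun m => m Set.univ) hmap
    simpa [Measure.map_apply measurable_subtype_coe MeasurableSet.univ] using this
  have : IsFiniteMeasure (μH[3] : Measure S3) :=
    ⟨by rw [huniv]; exact hausdorffMeasure_sphere_lt_top⟩
  refine integral_eq_zero_of_transitive_isometries sphereMeasure (μH[3] : Measure S3) ?_
    (fun x y => ?_) ?_ ?_
  · intro h0
    have := hausdorffMeasure_sphere_ne_zero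
    rw [← huniv, h0] at this
    simp at this
  · obtain ⟨e, he⟩ := exists_sphereIsometry_apply_eq x y
    exact ⟨sphereIsometry e, he, measurePreserving_sphereIsometry e,
      (sphereIsometry e).measurePreserving_hausdorffMeasure 3⟩
  · refine hf.comp_continuous (by fun_prop) fun ω => ?_
    simp [norm_smul, abs_of_pos hr]
  · have e1 : ∫ ω : S3, f (r • (ω : E4)) ∂μH[3]
        = ∫ x in sphere (0 : E4) 1, f (r • x) ∂μH[3] := by
      rw [← hmap, (MeasurableEmbedding.subtype_coe
        (isClosed_sphere.measurableSet)).integral_map]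
    rw [e1]
    have hme : MeasurableEmbedding (fun x : E4 => r • x) :=
      (Homeomorph.smulOfNeZero r hr.ne').measurableEmbedding
    have hpre : (fun x : E4 => r • x) ⁻¹' (sphere (0 : E4) r) = sphere 0 1 := by
      ext x
      simp [norm_smul, abs_of_pos hr, hr.ne']
    rw [← hpre, ← hme.integral_map (μ := μH[3].restrict _) (fun x => f x), ← hme.restrict_map]
    have hsm : Measure.map (fun x : E4 => r • x) μH[3]
        = (‖r‖₊ ^ (3 : ℝ))⁻¹ • (μH[3] : Measure E4) := by
      ext s hs
      rw [Measure.map_apply hme.measurable hs]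
      have := Measure.hausdorffMeasure_smul₀ (E := E4) (d := 3) (by norm_num) (inv_ne_zero hr.ne') s
      rw [Set.preimage_smul₀ hr.ne', this, nnnorm_inv, NNReal.inv_rpow]
      rfl
    rw [hsm, Measure.restrict_smul, integral_smul_nnreal_measure, h, smul_zero]

end SphereMeasure

section Polar

/-- The closed annulus with logarithmic radii between `a` and `b`. -/
def annulus (a b : ℝ) : Set E4 := {x | Real.exp a ≤ ‖x‖ ∧ ‖x‖ ≤ Real.exp b}

lemma isCompact_annulus (a b : ℝ) : IsCompact (annulus a b) := by
  have h : annulus a b = closedBall 0 (Real.exp b) ∩ {x | Real.exp a ≤ ‖x‖} := by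
    ext x; simp [annulus, and_comm]
  rw [h]
  exact (isCompact_closedBall _ _).inter_right (isClosed_le continuous_const continuous_norm)

lemma norm_smul_sphere {r : ℝ} (hr : 0 ≤ r) (ω : S3) : ‖r • (ω : E4)‖ = r := by
  simp [norm_smul, abs_of_nonneg hr]

lemma exp_smul_mem_annulus {a b t : ℝ} (ω : S3) :
    Real.exp t • (ω : E4) ∈ annulus a b ↔ t ∈ Set.Icc a b := by
  simp only [annulus, Set.mem_ofPred_eq, norm_smul_sphere (Real.exp_pos t).le, Real.exp_le_exp,
    Set.mem_Icc]

lemma setIntegral_annulus {a b : ℝ} (hab : a ≤ b) {g : E4 → ℝ}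
    (hg : ContinuousOn g (annulus a b)) :
    ∫ x in annulus a b, g x / ‖x‖ ^ 4
      = ∫ t in a..b, ∫ ω : S3, g (Real.exp t • (ω : E4)) ∂sphereMeasure := by
  have hmeas := (isCompact_annulus a b).isClosed.measurableSet
  set G : E4 → ℝ := (annulus a b).indicator fun x => g x / ‖x‖ ^ 4 with hG
  have hGint : Integrable G := by
    rw [hG, integrable_indicator_iff hmeas]
    refine ContinuousOn.integrableOn_compact (isCompact_annulus a b) ?_
    refine hg.div (by fun_prop) fun x hx => ?_
    have : 0 < ‖x‖ := (Real.exp_pos a).trans_le hx.1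
    positivity
  rw [← integral_indicator hmeas, ← hG]
  have hmp := (volume : Measure E4).measurePreserving_homeomorphUnitSphereProd
  have hemb := (homeomorphUnitSphereProd E4).measurableEmbedding
  have hdim : Module.finrank ℝ E4 - 1 = 3 := by simp
  rw [hdim] at hmp
  have e1 : ∫ x, G x = ∫ p : S3 × Set.Ioi (0 : ℝ), G ((p.2 : ℝ) • (p.1 : E4))
      ∂(sphereMeasure.prod (Measure.volumeIoiPow 3)) := by
    rw [sphereMeasure, ← hmp.integral_comp hemb]
    simp only [homeomorphUnitSphereProd_apply_snd_coe, homeomorphUnitSphereProd_apply_fst_coe]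
    have : ∀ x : ({0}ᶜ : Set E4), G (‖(x : E4)‖ • ‖(x : E4)‖⁻¹ • (x : E4)) = G x := fun x => by
      rw [smul_smul, mul_inv_cancel₀ (norm_ne_zero_iff.2 x.2), one_smul]
    simp only [this]
    rw [integral_subtype_comap (measurableSet_singleton _).compl fun x => G x,
      restrict_compl_singleton]
  have hInt : Integrable (fun p : S3 × Set.Ioi (0 : ℝ) => G ((p.2 : ℝ) • (p.1 : E4)))
      (sphereMeasure.prod (Measure.volumeIoiPow 3)) := by
    rw [sphereMeasure, ← hmp.integrable_comp_emb hemb]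
    have : (fun p : S3 × Set.Ioi (0 : ℝ) => G ((p.2 : ℝ) • (p.1 : E4)))
        ∘ (homeomorphUnitSphereProd E4) = G ∘ (Subtype.val : ({0}ᶜ : Set E4) → E4) := by
      ext x
      simp only [Function.comp, homeomorphUnitSphereProd_apply_snd_coe,
        homeomorphUnitSphereProd_apply_fst_coe]
      rw [smul_smul, mul_inv_cancel₀ (norm_ne_zero_iff.2 x.2), one_smul]
    rw [this, ← integrableOn_iff_comap_subtypeVal (measurableSet_singleton _).compl]
    exact hGint.integrableOn
  rw [e1, integral_prod_symm _ hInt, Measure.volumeIoiPow]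
  simp only [ENNReal.ofReal]
  rw [integral_withDensity_eq_integral_smul
    ((measurable_subtype_coe.pow_const _).real_toNNReal),
    integral_subtype_comap measurableSet_Ioi
      fun r : ℝ => Real.toNNReal (r ^ 3) • ∫ ω : S3, G (r • (ω : E4)) ∂sphereMeasure]
  have e2 : ∀ r ∈ Set.Ioi (0 : ℝ), (Real.toNNReal (r ^ 3) • ∫ ω : S3, G (r • (ω : E4))
      ∂sphereMeasure) = (Set.Icc (Real.exp a) (Real.exp b)).indicator
        (fun r => r⁻¹ * ∫ ω : S3, g (r • (ω : E4)) ∂sphereMeasure) r := by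
    intro r (hr : 0 < r)
    rw [NNReal.smul_def, Real.coe_toNNReal _ (by positivity), smul_eq_mul]
    have hn := norm_smul_sphere hr.le
    by_cases hr' : r ∈ Set.Icc (Real.exp a) (Real.exp b)
    · have hmem : ∀ ω : S3, r • (ω : E4) ∈ annulus a b := fun ω => by
        simpa [annulus, hn ω] using hr'
      simp only [hG, Set.indicator_of_mem hr', Set.indicator_of_mem (hmem _), hn, integral_div]
      field_simp
    · have hmem : ∀ ω : S3, r • (ω : E4) ∉ annulus a b := fun ω => by
        intro h
        exact hr' (by simpa [annulus, hn ω] using h)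
      simp only [hG, Set.indicator_of_notMem hr', Set.indicator_of_notMem (hmem _), integral_zero,
        mul_zero]
  rw [setIntegral_congr_fun measurableSet_Ioi e2, setIntegral_indicator measurableSet_Icc]
  have e3 : Set.Ioi (0 : ℝ) ∩ Set.Icc (Real.exp a) (Real.exp b) = Real.exp '' Set.Icc a b := by
    ext r
    simp only [Set.mem_inter_iff, Set.mem_Ioi, Set.mem_Icc, Set.mem_image]
    constructor
    · rintro ⟨h0, h1, h2⟩
      exact ⟨Real.log r, ⟨(Real.le_log_iff_exp_le h0).2 h1, (Real.log_le_iff_le_exp h0).2 h2⟩,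
        Real.exp_log h0⟩
    · rintro ⟨t, ⟨h1, h2⟩, rfl⟩
      exact ⟨Real.exp_pos t, Real.exp_le_exp.2 h1, Real.exp_le_exp.2 h2⟩
  rw [e3, integral_image_eq_integral_abs_deriv_smul measurableSet_Icc
    (fun t _ => (Real.hasDerivAt_exp t).hasDerivWithinAt) Real.exp_injective.injOn,
    intervalIntegral.integral_of_le hab, integral_Icc_eq_integral_Ioc]
  refine setIntegral_congr_fun measurableSet_Ioc fun t _ => ?_
  simp only [abs_of_pos (Real.exp_pos t), smul_eq_mul]
  rw [← mul_assoc, mul_inv_cancel₀ (Real.exp_pos t).ne', one_mul]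

end Polar

section DiffOps

/-- The derivative of `F` along the linear vector field `B`. -/
def linDeriv (B : E4 →L[ℝ] E4) (F : E4 → ℝ) (x : E4) : ℝ := fderiv ℝ F x (B x)

/-- Left multiplication by the three imaginary quaternion units on `ℝ⁴`. -/
def quat (a : Fin 3) : E4 →L[ℝ] E4 := LinearMap.toContinuousLinearMap
  { toFun := fun x => ![!₂[-x 1, x 0, -x 3, x 2], !₂[-x 2, x 3, x 0, -x 1],
      !₂[-x 3, -x 2, x 1, x 0]] a
    map_add' := fun x y => by
      fin_cases a <;> ext i <;> fin_cases i <;> simp <;> ring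
    map_smul' := fun c x => by
      fin_cases a <;> ext i <;> fin_cases i <;> simp }

lemma quat_apply (a : Fin 3) (x : E4) : quat a x = ![!₂[-x 1, x 0, -x 3, x 2],
    !₂[-x 2, x 3, x 0, -x 1], !₂[-x 3, -x 2, x 1, x 0]] a := rfl

lemma quat_quat (a : Fin 3) (x : E4) : quat a (quat a x) = -x := by
  fin_cases a <;> ext i <;> fin_cases i <;> simp [quat_apply]

lemma norm_rotation (a : Fin 3) (θ : ℝ) (x : E4) :
    ‖Real.cos θ • x + Real.sin θ • quat a x‖ = ‖x‖ := by
  rw [← sq_eq_sq₀ (norm_nonneg _) (norm_nonneg _), EuclideanSpace.real_norm_sq_eq,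
    EuclideanSpace.real_norm_sq_eq, Fin.sum_univ_four, Fin.sum_univ_four]
  have h := Real.sin_sq_add_cos_sq θ
  have h' : Real.cos θ ^ 2 = 1 - Real.sin θ ^ 2 := by linarith
  fin_cases a <;> simp [quat_apply] <;> ring_nf <;> rw [h'] <;> ring

/-- The linear isometry `cos θ + sin θ • quat a`. -/
def quatRotationAux (a : Fin 3) (θ : ℝ) : E4 →ₗᵢ[ℝ] E4 where
  toFun x := Real.cos θ • x + Real.sin θ • quat a x
  map_add' x y := by rw [map_add]; module
  map_smul' c x := by rw [map_smul, RingHom.id_apply]; module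
  norm_map' := norm_rotation a θ

/-- The one-parameter group of isometries generated by `quat a`. -/
def quatRotation (a : Fin 3) (θ : ℝ) : E4 ≃ₗᵢ[ℝ] E4 :=
  (quatRotationAux a θ).toLinearIsometryEquiv (Eq.refl (Module.finrank ℝ E4))

lemma quatRotation_apply (a : Fin 3) (θ : ℝ) (x : E4) :
    quatRotation a θ x = Real.cos θ • x + Real.sin θ • quat a x := rfl

lemma hasDerivAt_quatRotation (a : Fin 3) (θ : ℝ) (x : E4) :
    HasDerivAt (fun s => quatRotation a s x) (quat a (quatRotation a θ x)) θ := by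
  have h : HasDerivAt (fun s => Real.cos s • x + Real.sin s • quat a x) _ θ :=
    ((Real.hasDerivAt_cos θ).smul_const x).add ((Real.hasDerivAt_sin θ).smul_const (quat a x))
  have e : quat a (quatRotation a θ x) = -Real.sin θ • x + Real.cos θ • quat a x := by
    rw [quatRotation_apply, map_add, map_smul, map_smul, quat_quat]; module
  rw [e]
  exact h

lemma hasDerivAt_integral_sphere {a b : ℝ} {h h' : ℝ → S3 → ℝ}
    (hc : ∀ t ∈ Set.Ioo a b, Continuous (h t))
    (hd : ∀ t ∈ Set.Ioo a b, ∀ ω, HasDerivAt (fun s => h s ω) (h' t ω) t)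
    (hc' : ContinuousOn (Function.uncurry h') (Set.Ioo a b ×ˢ Set.univ))
    {t : ℝ} (ht : t ∈ Set.Ioo a b) :
    HasDerivAt (fun s => ∫ ω, h s ω ∂sphereMeasure) (∫ ω, h' t ω ∂sphereMeasure) t := by
  obtain ⟨ε, hε, hsub⟩ : ∃ ε > 0, closedBall t ε ⊆ Set.Ioo a b :=
    nhds_basis_closedBall.mem_iff.1 (isOpen_Ioo.mem_nhds ht)
  have hcont : ContinuousOn (Function.uncurry h') (closedBall t ε ×ˢ Set.univ) :=
    hc'.mono (Set.prod_mono_left hsub)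
  obtain ⟨C, hC⟩ := ((isCompact_closedBall t ε).prod isCompact_univ).exists_bound_of_continuousOn
    hcont
  have hct' : Continuous (h' t) := by
    refine continuousOn_univ.1 ((hc'.comp (f := fun ω : S3 => (t, ω)) (s := Set.univ)
      (by fun_prop) fun ω _ => ⟨ht, trivial⟩))
  have hcomp : ∀ {g : S3 → ℝ}, Continuous g → Integrable g sphereMeasure := fun hg =>
    hg.integrable_of_hasCompactSupport (HasCompactSupport.of_compactSpace _)
  refine (hasDerivAt_integral_of_dominated_loc_of_deriv_le (bound := fun _ => C)
    (closedBall_mem_nhds t hε) ?_ (hcomp (hc t ht)) hct'.aestronglyMeasurable ?_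
    (integrable_const C) ?_).2
  · filter_upwards [isOpen_Ioo.mem_nhds ht] with s hs using (hc s hs).aestronglyMeasurable
  · exact Filter.Eventually.of_forall fun ω s hs => hC (s, ω) ⟨hs, trivial⟩
  · exact Filter.Eventually.of_forall fun ω s hs => hd s (hsub hs) ω

variable {U : Set E4} {F G : E4 → ℝ}

lemma ContDiffOn.linDeriv (hU : IsOpen U) (hF : ContDiffOn ℝ (⊤ : ℕ∞) F U) (B : E4 →L[ℝ] E4) :
    ContDiffOn ℝ (⊤ : ℕ∞) (linDeriv B F) U := by
  have h := hF.fderiv_of_isOpen hU (m := (⊤ : ℕ∞)) (by simp)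
  exact h.clm_apply B.contDiff.contDiffOn

lemma ContDiffOn.hasFDerivAt_of_isOpen (hU : IsOpen U) (hF : ContDiffOn ℝ (⊤ : ℕ∞) F U) {x : E4}
    (hx : x ∈ U) : HasFDerivAt F (fderiv ℝ F x) x :=
  ((hF.contDiffAt (hU.mem_nhds hx)).differentiableAt (by simp)).hasFDerivAt

lemma integral_linDeriv_quat (hU : IsOpen U) (hS : sphere 0 1 ⊆ U) (hF : ContDiffOn ℝ (⊤ : ℕ∞) F U)
    (a : Fin 3) : ∫ ω : S3, linDeriv (quat a) F ω ∂sphereMeasure = 0 := by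
  have hmem : ∀ s (ω : S3), quatRotation a s ω ∈ U := fun s ω => hS (by simp)
  have hcr : Continuous fun p : ℝ × S3 => quatRotation a p.1 p.2 := by
    simp only [quatRotation_apply]; fun_prop
  have hd : HasDerivAt (fun s => ∫ ω : S3, F (quatRotation a s ω) ∂sphereMeasure)
      (∫ ω : S3, linDeriv (quat a) F (quatRotation a 0 ω) ∂sphereMeasure) 0 := by
    refine hasDerivAt_integral_sphere (a := -1) (b := 1)
      (h := fun s (ω : S3) => F (quatRotation a s ω))
      (h' := fun s (ω : S3) => linDeriv (quat a) F (quatRotation a s ω)) ?_ ?_ ?_ (by simp)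
    · intro t _
      exact hF.continuousOn.comp_continuous (by fun_prop) (hmem t)
    · intro t _ ω
      exact (hF.hasFDerivAt_of_isOpen hU (hmem t ω)).comp_hasDerivAt t
        (hasDerivAt_quatRotation a t ω)
    · refine Continuous.continuousOn ?_
      exact (hF.linDeriv hU (quat a)).continuousOn.comp_continuous hcr fun p => hmem _ _
  have hconst : (fun s => ∫ ω : S3, F (quatRotation a s ω) ∂sphereMeasure)
      = fun _ => ∫ ω : S3, F ω ∂sphereMeasure := by
    ext s
    exact (measurePreserving_sphereIsometry (quatRotation a s)).integral_comp
      (sphereIsometry (quatRotation a s)).toHomeomorph.measurableEmbedding (fun ω : S3 => F ω)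
  rw [hconst] at hd
  have h0 := hd.unique (hasDerivAt_const (0 : ℝ) _)
  simpa [quatRotation_apply] using h0

lemma continuous_comp_coe (hS : sphere 0 1 ⊆ U) (hF : ContinuousOn F U) :
    Continuous fun ω : S3 => F ω :=
  hF.comp_continuous continuous_subtype_val fun ω => hS ω.2

lemma integrable_coe_of_continuousOn (hS : sphere 0 1 ⊆ U) (hF : ContinuousOn F U) :
    Integrable (fun ω : S3 => F ω) sphereMeasure :=
  (continuous_comp_coe hS hF).integrable_of_hasCompactSupport (HasCompactSupport.of_compactSpace _)

lemma integral_linDeriv_quat_mul (hU : IsOpen U) (hS : sphere 0 1 ⊆ U)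
    (hF : ContDiffOn ℝ (⊤ : ℕ∞) F U)
    (hG : ContDiffOn ℝ (⊤ : ℕ∞) G U) (a : Fin 3) :
    ∫ ω : S3, linDeriv (quat a) F ω * G ω ∂sphereMeasure
      = -∫ ω : S3, F ω * linDeriv (quat a) G ω ∂sphereMeasure := by
  have h := integral_linDeriv_quat hU hS (hF.mul hG) a
  have e : ∀ ω : S3, linDeriv (quat a) (fun x => F x * G x) ω
      = linDeriv (quat a) F ω * G ω + F ω * linDeriv (quat a) G ω := by
    intro ω
    have h1 : HasFDerivAt (fun x => F x * G x) _ _ :=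
      (hF.hasFDerivAt_of_isOpen hU (hS ω.2)).mul (hG.hasFDerivAt_of_isOpen hU (hS ω.2))
    unfold linDeriv
    rw [h1.fderiv]
    simp [mul_comm]; ring
  have e' : ∫ ω : S3, (linDeriv (quat a) F ω * G ω + F ω * linDeriv (quat a) G ω) ∂sphereMeasure
      = 0 := by
    rw [← h]; exact integral_congr_ae (Filter.Eventually.of_forall fun ω => (e ω).symm)
  have i1 : Integrable (fun ω : S3 => linDeriv (quat a) F ω * G ω) sphereMeasure :=
    integrable_coe_of_continuousOn hS ((hF.linDeriv hU (quat a)).continuousOn.mul hG.continuousOn)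
  have i2 : Integrable (fun ω : S3 => F ω * linDeriv (quat a) G ω) sphereMeasure :=
    integrable_coe_of_continuousOn hS (hF.continuousOn.mul (hG.linDeriv hU (quat a)).continuousOn)
  rw [integral_add i1 i2] at e'
  linarith

/-- The spherical Laplacian, written as a sum of squares of quaternionic rotation fields. -/
def sphLap (F : E4 → ℝ) (x : E4) : ℝ := ∑ a, linDeriv (quat a) (linDeriv (quat a) F) x

lemma ContDiffOn.sphLap (hU : IsOpen U) (hF : ContDiffOn ℝ (⊤ : ℕ∞) F U) :
    ContDiffOn ℝ (⊤ : ℕ∞) (sphLap F) U :=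
  ContDiffOn.sum fun _ _ => (hF.linDeriv hU _).linDeriv hU _

lemma integral_sphLap_mul (hU : IsOpen U) (hS : sphere 0 1 ⊆ U) (hF : ContDiffOn ℝ (⊤ : ℕ∞) F U)
    (hG : ContDiffOn ℝ (⊤ : ℕ∞) G U) :
    ∫ ω : S3, sphLap F ω * G ω ∂sphereMeasure = ∫ ω : S3, F ω * sphLap G ω ∂sphereMeasure := by
  simp only [sphLap, Finset.sum_mul, Finset.mul_sum]
  rw [integral_finsetSum, integral_finsetSum]
  · refine Finset.sum_congr rfl fun a _ => ?_
    rw [integral_linDeriv_quat_mul hU hS (hF.linDeriv hU _) hG,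
      integral_linDeriv_quat_mul hU hS hF (hG.linDeriv hU _), neg_neg]
  · exact fun a _ => integrable_coe_of_continuousOn hS
      (hF.continuousOn.mul ((hG.linDeriv hU _).linDeriv hU _).continuousOn)
  · exact fun a _ => integrable_coe_of_continuousOn hS
      (((hF.linDeriv hU _).linDeriv hU _).continuousOn.mul hG.continuousOn)

lemma linDeriv_linDeriv (hU : IsOpen U) (hF : ContDiffOn ℝ (⊤ : ℕ∞) F U) {x : E4} (hx : x ∈ U)
    (B C : E4 →L[ℝ] E4) : linDeriv C (linDeriv B F) x
      = fderiv ℝ (fderiv ℝ F) x (C x) (B x) + fderiv ℝ F x (B (C x)) := by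
  have h1 : HasFDerivAt (fderiv ℝ F) (fderiv ℝ (fderiv ℝ F) x) x :=
    (((hF.fderiv_of_isOpen hU (m := (⊤ : ℕ∞)) (by simp)).contDiffAt (hU.mem_nhds
      hx)).differentiableAt (by simp)).hasFDerivAt
  have h2 := h1.clm_apply (B.hasFDerivAt (x := x))
  unfold linDeriv
  rw [h2.fderiv]
  simp [add_comm]

lemma sum_bilin_quat (M : E4 →L[ℝ] E4 →L[ℝ] ℝ) (x : E4) :
    M x x + ∑ a, M (quat a x) (quat a x) = ‖x‖ ^ 2 *
      ∑ i, M (EuclideanSpace.single i (1 : ℝ)) (EuclideanSpace.single i (1 : ℝ)) := by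
  have key : ∀ y : E4, M y y = ∑ i, ∑ j, y i * y j *
      M (EuclideanSpace.single i (1 : ℝ)) (EuclideanSpace.single j (1 : ℝ)) := by
    intro y
    have hy : y = ∑ i, y i • EuclideanSpace.single i (1 : ℝ) := by
      ext j; simp [Finset.sum_apply, Pi.single_apply]
    conv_lhs => rw [hy]
    simp only [map_sum, map_smul, _root_.sum_apply, _root_.smul_apply,
      smul_eq_mul, Finset.mul_sum]
    rw [Finset.sum_comm]
    refine Finset.sum_congr rfl fun i _ => Finset.sum_congr rfl fun j _ => by ring
  rw [EuclideanSpace.real_norm_sq_eq, key x]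
  simp only [key (quat _ x), Fin.sum_univ_three, Fin.sum_univ_four]
  simp [quat_apply]
  ring

lemma norm_sq_mul_lap (hU : IsOpen U) (hF : ContDiffOn ℝ (⊤ : ℕ∞) F U) {x : E4} (hx : x ∈ U) :
    ‖x‖ ^ 2 * lap F x = linDeriv (.id ℝ E4) (linDeriv (.id ℝ E4) F) x
      + 2 * linDeriv (.id ℝ E4) F x + sphLap F x := by
  have h := sum_bilin_quat (fderiv ℝ (fderiv ℝ F) x) x
  have hl : lap F x = ∑ i, fderiv ℝ (fderiv ℝ F) x (EuclideanSpace.single i (1 : ℝ))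
      (EuclideanSpace.single i (1 : ℝ)) := by
    simp [lap, iteratedFDeriv_two_apply]
  rw [hl, ← h, sphLap, linDeriv_linDeriv hU hF hx]
  simp only [linDeriv_linDeriv hU hF hx, quat_quat, Finset.sum_add_distrib, map_neg]
  simp [linDeriv]
  ring

end DiffOps

section RadialODE

/-- The open annulus with logarithmic radii between `a` and `b`. -/
def openAnnulus (a b : ℝ) : Set E4 := {x | Real.exp a < ‖x‖ ∧ ‖x‖ < Real.exp b}

lemma isOpen_openAnnulus (a b : ℝ) : IsOpen (openAnnulus a b) :=
  (isOpen_lt continuous_const continuous_norm).inter (isOpen_lt continuous_norm continuous_const)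

lemma exp_smul_mem_openAnnulus {a b t : ℝ} (ω : S3) :
    Real.exp t • (ω : E4) ∈ openAnnulus a b ↔ t ∈ Set.Ioo a b := by
  simp only [openAnnulus, Set.mem_ofPred_eq, norm_smul_sphere (Real.exp_pos t).le, Real.exp_lt_exp,
    Set.mem_Ioo]

variable {a b : ℝ} {f Y : E4 → ℝ}

/-- The coefficient of `Y` in the restriction of `f` to the sphere of radius `exp t`. -/
def sphCoeff (f Y : E4 → ℝ) (t : ℝ) : ℝ :=
  ∫ ω : S3, f (Real.exp t • (ω : E4)) * Y ω ∂sphereMeasure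

lemma hasDerivAt_sphCoeff (hf : ContDiffOn ℝ (⊤ : ℕ∞) f (openAnnulus a b)) (hY : Continuous Y)
    {t : ℝ} (ht : t ∈ Set.Ioo a b) :
    HasDerivAt (sphCoeff f Y) (sphCoeff (linDeriv (.id ℝ E4) f) Y t) t := by
  have hU := isOpen_openAnnulus a b
  have hYc : Continuous fun ω : S3 => Y ω := hY.comp continuous_subtype_val
  refine hasDerivAt_integral_sphere (a := a) (b := b)
    (h := fun s (ω : S3) => f (Real.exp s • (ω : E4)) * Y ω)
    (h' := fun s (ω : S3) => linDeriv (.id ℝ E4) f (Real.exp s • (ω : E4)) * Y ω) ?_ ?_ ?_ ht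
  · intro s hs
    exact (hf.continuousOn.comp_continuous (by fun_prop)
      fun ω => (exp_smul_mem_openAnnulus ω).2 hs).mul hYc
  · intro s hs ω
    have h1 := (hf.hasFDerivAt_of_isOpen hU ((exp_smul_mem_openAnnulus ω).2 hs)).comp_hasDerivAt s
      ((Real.hasDerivAt_exp s).smul_const (ω : E4))
    exact h1.mul_const (Y ω)
  · refine ContinuousOn.mul ?_ (by fun_prop)
    exact (hf.linDeriv hU (.id ℝ E4)).continuousOn.comp (by fun_prop)
      fun p hp => (exp_smul_mem_openAnnulus p.2).2 hp.1

lemma linDeriv_comp_smul (B : E4 →L[ℝ] E4) (f : E4 → ℝ) (c : ℝ) :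
    linDeriv B (fun x => f (c • x)) = fun x => linDeriv B f (c • x) := by
  ext x
  unfold linDeriv
  rw [fderiv_comp_smul, map_smul]
  simp

lemma sphLap_comp_smul (f : E4 → ℝ) (c : ℝ) :
    sphLap (fun x => f (c • x)) = fun x => sphLap f (c • x) := by
  ext x
  simp only [sphLap, linDeriv_comp_smul]

lemma ContDiffOn.lap {U : Set E4} (hU : IsOpen U) (hf : ContDiffOn ℝ (⊤ : ℕ∞) f U) :
    ContDiffOn ℝ (⊤ : ℕ∞) (lap f) U := by
  have h1 := hf.fderiv_of_isOpen hU (m := (⊤ : ℕ∞)) (by simp)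
  have h2 := h1.fderiv_of_isOpen hU (m := (⊤ : ℕ∞)) (by simp)
  have hl : _root_.lap f = fun x => ∑ i, fderiv ℝ (fderiv ℝ f) x
      (EuclideanSpace.single i (1 : ℝ)) (EuclideanSpace.single i (1 : ℝ)) := by
    ext x
    simp [_root_.lap, iteratedFDeriv_two_apply]
  rw [hl]
  exact ContDiffOn.sum fun i _ => (h2.clm_apply contDiffOn_const).clm_apply contDiffOn_const

lemma sphCoeff_ode (hf : ContDiffOn ℝ (⊤ : ℕ∞) f (openAnnulus a b))
    (hY : ContDiff ℝ (⊤ : ℕ∞) Y) {k : ℕ}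
    (hYk : ∀ ω : S3, sphLap Y ω = -(k * (k + 2)) * Y ω) {t : ℝ} (ht : t ∈ Set.Ioo a b) :
    sphCoeff (linDeriv (.id ℝ E4) (linDeriv (.id ℝ E4) f)) Y t
      + 2 * sphCoeff (linDeriv (.id ℝ E4) f) Y t - k * (k + 2) * sphCoeff f Y t
      = Real.exp (2 * t) * sphCoeff (lap f) Y t := by
  have hU := isOpen_openAnnulus a b
  have hm : ∀ ω : S3, Real.exp t • (ω : E4) ∈ openAnnulus a b :=
    fun ω => (exp_smul_mem_openAnnulus ω).2 ht
  have hi : ∀ g : E4 → ℝ, ContDiffOn ℝ (⊤ : ℕ∞) g (openAnnulus a b) →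
      Integrable (fun ω : S3 => g (Real.exp t • (ω : E4)) * Y ω) sphereMeasure := by
    intro g hg
    refine Continuous.integrable_of_hasCompactSupport ?_ (HasCompactSupport.of_compactSpace _)
    exact (hg.continuousOn.comp_continuous (by fun_prop) hm).mul
      (hY.continuous.comp continuous_subtype_val)
  set E := linDeriv (.id ℝ E4)
  have hE := hf.linDeriv hU (.id ℝ E4)
  have hEE := hE.linDeriv hU (.id ℝ E4)
  have hparts : ∫ ω : S3, sphLap f (Real.exp t • (ω : E4)) * Y ω ∂sphereMeasure
      = -(k * (k + 2)) * sphCoeff f Y t := by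
    set V : Set E4 := (fun x => Real.exp t • x) ⁻¹' openAnnulus a b
    have hV : IsOpen V := hU.preimage (by fun_prop)
    have hFV : ContDiffOn ℝ (⊤ : ℕ∞) (fun x => f (Real.exp t • x)) V :=
      hf.comp (by fun_prop) fun x hx => hx
    have h := integral_sphLap_mul hV (fun x hx => hm ⟨x, hx⟩) hFV hY.contDiffOn
    rw [sphLap_comp_smul] at h
    rw [h, sphCoeff, ← integral_const_mul]
    refine integral_congr_ae (Filter.Eventually.of_forall fun ω => ?_)
    simp only [hYk]; ring
  have hlap : ∀ ω : S3, Real.exp (2 * t) * (lap f (Real.exp t • (ω : E4)) * Y ω)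
      = E (E f) (Real.exp t • (ω : E4)) * Y ω + 2 * (E f (Real.exp t • (ω : E4)) * Y ω)
        + sphLap f (Real.exp t • (ω : E4)) * Y ω := by
    intro ω
    have h := norm_sq_mul_lap hU hf (hm ω)
    rw [norm_smul_sphere (Real.exp_pos t).le] at h
    rw [two_mul t, Real.exp_add]
    linear_combination Y ω * h
  have e : ∫ ω : S3, Real.exp (2 * t) * (lap f (Real.exp t • (ω : E4)) * Y ω) ∂sphereMeasure
      = ∫ ω : S3, (E (E f) (Real.exp t • (ω : E4)) * Y ω + 2 * (E f (Real.exp t • (ω : E4)) * Y ω)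
        + sphLap f (Real.exp t • (ω : E4)) * Y ω) ∂sphereMeasure :=
    integral_congr_ae (Filter.Eventually.of_forall hlap)
  have i1 : Integrable (fun ω : S3 => E (E f) (Real.exp t • (ω : E4)) * Y ω) sphereMeasure :=
    hi _ hEE
  have i2 : Integrable (fun ω : S3 => 2 * (E f (Real.exp t • (ω : E4)) * Y ω)) sphereMeasure :=
    (hi _ hE).const_mul 2
  have i12 : Integrable (fun ω : S3 => E (E f) (Real.exp t • (ω : E4)) * Y ω
      + 2 * (E f (Real.exp t • (ω : E4)) * Y ω)) sphereMeasure := i1.add i2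
  rw [integral_add i12 (hi _ (hf.sphLap hU)), integral_add i1 i2, integral_const_mul,
    integral_const_mul,
    hparts] at e
  unfold sphCoeff at e ⊢
  linarith

lemma sphCoeff_eq_exp_sum (hf : ContDiffOn ℝ (⊤ : ℕ∞) f (openAnnulus a b))
    (hff : ∀ x ∈ openAnnulus a b, lap (lap f) x = 0)
    (hY : ContDiff ℝ (⊤ : ℕ∞) Y) {k : ℕ} (hk : 1 ≤ k)
    (hYk : ∀ ω : S3, sphLap Y ω = -(k * (k + 2)) * Y ω) :
    ∃ c₁ c₂ c₃ c₄ : ℝ, ∀ t ∈ Set.Ioo a b, sphCoeff f Y t = c₁ * Real.exp (k * t)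
      + c₂ * Real.exp (-(k * t)) + c₃ * Real.exp ((k + 2) * t)
      + c₄ * Real.exp (-((k + 2) * t)) := by
  have hU := isOpen_openAnnulus a b
  have hl := hf.lap hU
  refine exp_sum_of_fourth_order hk
    (fun t ht => hasDerivAt_sphCoeff hf hY.continuous ht)
    (fun t ht => hasDerivAt_sphCoeff (hf.linDeriv hU _) hY.continuous ht)
    (fun t ht => hasDerivAt_sphCoeff hl hY.continuous ht)
    (fun t ht => hasDerivAt_sphCoeff (hl.linDeriv hU _) hY.continuous ht)
    (fun t ht => sphCoeff_ode hf hY hYk ht) (fun t ht => ?_)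
  rw [sphCoeff_ode hl hY hYk ht]
  have : sphCoeff (lap (lap f)) Y t = 0 := by
    unfold sphCoeff
    rw [integral_eq_zero_of_ae]
    refine Filter.Eventually.of_forall fun ω => ?_
    simp [hff _ ((exp_smul_mem_openAnnulus ω).2 ht)]
  rw [this, mul_zero]

end RadialODE

section PolynomialFunctions

open MvPolynomial

/-- The polynomial function on `ℝ⁴` attached to a polynomial in four variables. -/
def polyFun (p : MvPolynomial (Fin 4) ℝ) (x : E4) : ℝ := eval (fun i => x i) p

lemma hasFDerivAt_polyFun (p : MvPolynomial (Fin 4) ℝ) (x : E4) :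
    HasFDerivAt (polyFun p) (∑ i, polyFun (pderiv i p) x • EuclideanSpace.proj (𝕜 := ℝ) i) x := by
  induction p using MvPolynomial.induction_on with
  | C a =>
    have : polyFun (C a) = fun _ => a := by ext y; simp [polyFun]
    rw [this]
    simpa [polyFun] using hasFDerivAt_const a x
  | add p q hp hq =>
    have : polyFun (p + q) = polyFun p + polyFun q := by ext y; simp [polyFun]
    rw [this]
    have e : (∑ i, polyFun (pderiv i (p + q)) x • (EuclideanSpace.proj i : E4 →L[ℝ] ℝ))
        = (∑ i, polyFun (pderiv i p) x • (EuclideanSpace.proj i : E4 →L[ℝ] ℝ))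
          + ∑ i, polyFun (pderiv i q) x • (EuclideanSpace.proj i : E4 →L[ℝ] ℝ) := by
      rw [← Finset.sum_add_distrib]
      refine Finset.sum_congr rfl fun i _ => ?_
      simp [polyFun, add_smul]
    rw [e]
    exact hp.add hq
  | mul_X p j hp =>
    have : polyFun (p * X j) = fun y => polyFun p y * y j := by ext y; simp [polyFun]
    rw [this]
    have hj : HasFDerivAt (fun y : E4 => y j) (EuclideanSpace.proj (𝕜 := ℝ) j : E4 →L[ℝ] ℝ) x :=
      (EuclideanSpace.proj (𝕜 := ℝ) j : E4 →L[ℝ] ℝ).hasFDerivAt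
    have e : (∑ i, polyFun (pderiv i (p * X j)) x • (EuclideanSpace.proj i : E4 →L[ℝ] ℝ))
        = polyFun p x • (EuclideanSpace.proj j : E4 →L[ℝ] ℝ)
          + x j • ∑ i, polyFun (pderiv i p) x • (EuclideanSpace.proj i : E4 →L[ℝ] ℝ) := by
      simp only [Derivation.leibniz, pderiv_X, smul_eq_mul, polyFun, map_add, map_mul, eval_X,
        add_smul, Finset.sum_add_distrib, Finset.smul_sum, smul_smul]
      congr 1
      rw [Finset.sum_eq_single j]
      · simp
      · intro i _ hij
        simp [hij.symm]
      · simp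
    rw [e]
    exact hp.mul hj

lemma contDiff_polyFun (p : MvPolynomial (Fin 4) ℝ) : ContDiff ℝ (⊤ : ℕ∞) (polyFun p) := by
  induction p using MvPolynomial.induction_on with
  | C a =>
    have : polyFun (C a) = fun _ => a := by ext y; simp [polyFun]
    rw [this]
    exact contDiff_const
  | add p q hp hq =>
    have : polyFun (p + q) = polyFun p + polyFun q := by ext y; simp [polyFun]
    rw [this]
    exact hp.add hq
  | mul_X p j hp =>
    have : polyFun (p * X j) = fun y => polyFun p y * y j := by ext y; simp [polyFun]
    rw [this]
    exact hp.mul (EuclideanSpace.proj (𝕜 := ℝ) j : E4 →L[ℝ] ℝ).contDiff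

/-- The Laplacian of a polynomial. -/
def polyLap : MvPolynomial (Fin 4) ℝ →ₗ[ℝ] MvPolynomial (Fin 4) ℝ :=
  ∑ i, (pderiv i).toLinearMap ∘ₗ (pderiv i).toLinearMap

/-- The Euler operator on polynomials. -/
def polyEuler : MvPolynomial (Fin 4) ℝ →ₗ[ℝ] MvPolynomial (Fin 4) ℝ :=
  ∑ i, LinearMap.mulLeft ℝ (X i) ∘ₗ (pderiv i).toLinearMap

/-- A polynomial operator which restricts to the spherical Laplacian on the unit sphere. -/
def polySph : MvPolynomial (Fin 4) ℝ →ₗ[ℝ] MvPolynomial (Fin 4) ℝ :=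
  polyLap - polyEuler ∘ₗ polyEuler - (2 : ℝ) • polyEuler

lemma polyLap_apply (p : MvPolynomial (Fin 4) ℝ) :
    polyLap p = ∑ i, pderiv i (pderiv i p) := by
  simp [polyLap]

lemma polyEuler_apply (p : MvPolynomial (Fin 4) ℝ) :
    polyEuler p = ∑ i, X i * pderiv i p := by
  simp [polyEuler]

lemma fderiv_polyFun_apply (p : MvPolynomial (Fin 4) ℝ) (x v : E4) :
    fderiv ℝ (polyFun p) x v = ∑ i, polyFun (pderiv i p) x * v i := by
  rw [(hasFDerivAt_polyFun p x).fderiv]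
  simp

lemma linDeriv_id_polyFun (p : MvPolynomial (Fin 4) ℝ) :
    linDeriv (.id ℝ E4) (polyFun p) = polyFun (polyEuler p) := by
  ext x
  rw [linDeriv, fderiv_polyFun_apply, polyEuler_apply]
  simp [polyFun, mul_comm]

lemma lap_polyFun (p : MvPolynomial (Fin 4) ℝ) (x : E4) :
    lap (polyFun p) x = polyFun (polyLap p) x := by
  have h1 : ∀ i, (fun y => fderiv ℝ (polyFun p) y (EuclideanSpace.single i (1 : ℝ)))
      = polyFun (pderiv i p) := by
    intro i
    ext y
    rw [fderiv_polyFun_apply]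
    simp
  have hd : DifferentiableAt ℝ (fderiv ℝ (polyFun p)) x :=
    (((contDiff_polyFun p).fderiv_right (m := (⊤ : ℕ∞)) (by simp)).differentiable (by simp)) x
  have h2 : ∀ i, fderiv ℝ (fderiv ℝ (polyFun p)) x (EuclideanSpace.single i (1 : ℝ))
      (EuclideanSpace.single i (1 : ℝ)) = polyFun (pderiv i (pderiv i p)) x := by
    intro i
    have h3 := hd.hasFDerivAt.clm_apply
      (hasFDerivAt_const (EuclideanSpace.single i (1 : ℝ) : E4) x)
    rw [h1 i] at h3
    have h4 := congrArg (fun T : E4 →L[ℝ] ℝ => T (EuclideanSpace.single i (1 : ℝ))) h3.fderiv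
    simp only [fderiv_polyFun_apply] at h4
    simpa [Pi.single_apply] using h4.symm
  simp only [lap, iteratedFDeriv_two_apply, polyLap_apply]
  simp [h2]
  simp [polyFun]

lemma sphLap_polyFun (p : MvPolynomial (Fin 4) ℝ) (ω : S3) :
    sphLap (polyFun p) ω = polyFun (polySph p) ω := by
  have h := norm_sq_mul_lap isOpen_univ (contDiff_polyFun p).contDiffOn (Set.mem_univ (ω : E4))
  have hn : ‖(ω : E4)‖ = 1 := by simp
  rw [hn, lap_polyFun, linDeriv_id_polyFun, linDeriv_id_polyFun] at h
  have : polyFun (polySph p) ω = polyFun (polyLap p) ω - polyFun (polyEuler (polyEuler p)) ω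
      - 2 * polyFun (polyEuler p) ω := by
    simp [polyFun, polySph, MvPolynomial.smul_eval]
  rw [this]
  linarith

/-- Polynomials spanned by the monomials of degree less than `n`. -/
def polyLT (n : ℕ) : Submodule ℝ (MvPolynomial (Fin 4) ℝ) :=
  Submodule.span ℝ ((fun s => monomial s (1 : ℝ)) '' {s : Fin 4 →₀ ℕ | s.degree < n})

instance (n : ℕ) : FiniteDimensional ℝ (polyLT n) :=
  FiniteDimensional.span_of_finite ℝ ((Finsupp.finite_of_degree_lt n).image _)

lemma polyLT_mono {m n : ℕ} (h : m ≤ n) : polyLT m ≤ polyLT n :=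
  Submodule.span_mono (Set.image_mono fun _ hs => lt_of_lt_of_le hs h)

lemma monomial_mem_polyLT {n : ℕ} {s : Fin 4 →₀ ℕ} (hs : s.degree < n) (c : ℝ) :
    monomial s c ∈ polyLT n := by
  have : monomial s c = c • monomial s (1 : ℝ) := by rw [smul_monomial, smul_eq_mul, mul_one]
  rw [this]
  exact Submodule.smul_mem _ _ (Submodule.subset_span ⟨s, hs, rfl⟩)

lemma pderiv_mem_polyLT {n : ℕ} {p : MvPolynomial (Fin 4) ℝ} (hp : p ∈ polyLT (n + 1))
    (i : Fin 4) : pderiv i p ∈ polyLT n := by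
  induction hp using Submodule.span_induction with
  | mem p hp =>
    obtain ⟨s, hs, rfl⟩ := hp
    simp only [pderiv_monomial, one_mul]
    by_cases h0 : s i = 0
    · simp [h0]
    · refine monomial_mem_polyLT ?_ _
      have hle : Finsupp.single i 1 ≤ s := by
        rw [Finsupp.single_le_iff]; omega
      have hadd : s - Finsupp.single i 1 + Finsupp.single i 1 = s := tsub_add_cancel_of_le hle
      have hd := congrArg Finsupp.degree hadd
      rw [map_add, Finsupp.degree_single] at hd
      have : s.degree < n + 1 := hs
      omega
  | zero => simp
  | add p q _ _ hp hq => rw [map_add]; exact Submodule.add_mem _ hp hq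
  | smul c p _ hp => rw [Derivation.map_smul]; exact Submodule.smul_mem _ _ hp

lemma polyLap_mem_polyLT {n : ℕ} {p : MvPolynomial (Fin 4) ℝ} (hp : p ∈ polyLT (n + 1)) :
    polyLap p ∈ polyLT n := by
  rw [polyLap_apply]
  exact Submodule.sum_mem _ fun i _ => pderiv_mem_polyLT
    (polyLT_mono (Nat.le_succ n) (pderiv_mem_polyLT hp i)) i

lemma polySph_monomial (s : Fin 4 →₀ ℕ) :
    polySph (monomial s (1 : ℝ)) = polyLap (monomial s 1)
      - ((s.degree : ℝ) * (s.degree + 2)) • monomial s (1 : ℝ) := by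
  have h : polyEuler (monomial s (1 : ℝ)) = (s.degree : ℝ) • monomial s (1 : ℝ) := by
    rw [polyEuler_apply, (isHomogeneous_monomial (1 : ℝ) rfl).sum_X_mul_pderiv,
      Nat.cast_smul_eq_nsmul]
  simp only [polySph, LinearMap.sub_apply, LinearMap.comp_apply, LinearMap.smul_apply, h, map_smul]
  module

lemma polySph_mem_polyLT {n : ℕ} {p : MvPolynomial (Fin 4) ℝ} (hp : p ∈ polyLT n) :
    polySph p ∈ polyLT n := by
  induction hp using Submodule.span_induction with
  | mem p hp =>
    obtain ⟨s, hs, rfl⟩ := hp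
    simp only [polySph_monomial]
    refine Submodule.sub_mem _ ?_ (Submodule.smul_mem _ _ (monomial_mem_polyLT hs 1))
    exact polyLap_mem_polyLT (polyLT_mono (Nat.le_succ n) (monomial_mem_polyLT hs 1))
  | zero => simp
  | add p q _ _ hp hq => rw [map_add]; exact Submodule.add_mem _ hp hq
  | smul c p _ hp => rw [map_smul]; exact Submodule.smul_mem _ _ hp

lemma polySph_add_smul_mem_polyLT {n : ℕ} {p : MvPolynomial (Fin 4) ℝ}
    (hp : p ∈ polyLT (n + 1)) : polySph p + ((n : ℝ) * (n + 2)) • p ∈ polyLT n := by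
  induction hp using Submodule.span_induction with
  | mem p hp =>
    obtain ⟨s, hs, rfl⟩ := hp
    have hs' : s.degree < n + 1 := hs
    simp only
    by_cases hn : s.degree = n
    · rw [polySph_monomial, hn, sub_add_cancel]
      exact polyLap_mem_polyLT (monomial_mem_polyLT hs 1)
    · have hm : monomial s (1 : ℝ) ∈ polyLT n := monomial_mem_polyLT (by omega) 1
      exact Submodule.add_mem _ (polySph_mem_polyLT hm) (Submodule.smul_mem _ _ hm)
  | zero => simp
  | add p q _ _ hp hq =>
    convert Submodule.add_mem _ hp hq using 1
    rw [map_add]; module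
  | smul c p _ hp =>
    convert Submodule.smul_mem _ c hp using 1
    rw [map_smul]; module

lemma exists_const_of_mem_polyLT_one {p : MvPolynomial (Fin 4) ℝ} (hp : p ∈ polyLT 1) :
    ∃ c, ∀ x, polyFun p x = c := by
  induction hp using Submodule.span_induction with
  | mem p hp =>
    obtain ⟨s, hs, rfl⟩ := hp
    have h0 : s.degree = 0 := Nat.lt_one_iff.1 hs
    rw [Finsupp.degree_eq_zero_iff] at h0
    exact ⟨1, fun x => by simp [polyFun, h0]⟩
  | zero => exact ⟨0, fun x => by simp [polyFun]⟩
  | add p q _ _ hp hq =>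
    obtain ⟨c, hc⟩ := hp
    obtain ⟨d, hd⟩ := hq
    refine ⟨c + d, fun x => ?_⟩
    rw [← hc x, ← hd x]; simp [polyFun]
  | smul a p _ hp =>
    obtain ⟨c, hc⟩ := hp
    refine ⟨a * c, fun x => ?_⟩
    rw [← hc x]; simp [polyFun, MvPolynomial.smul_eval]

lemma exists_mem_polyLT (p : MvPolynomial (Fin 4) ℝ) : ∃ n, p ∈ polyLT n := by
  refine ⟨p.totalDegree + 1, ?_⟩
  suffices h : ∑ v ∈ p.support, monomial v (coeff v p) ∈ polyLT (p.totalDegree + 1) by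
    rwa [← p.as_sum] at h
  refine Submodule.sum_mem _ fun s hs => monomial_mem_polyLT ?_ _
  exact Nat.lt_succ_of_le (le_totalDegree hs)

end PolynomialFunctions

section SphericalHarmonics

open MvPolynomial

/-- The restriction of polynomials to the unit sphere, as continuous functions. -/
def sphPoly : MvPolynomial (Fin 4) ℝ →ₐ[ℝ] C(S3, ℝ) :=
  aeval fun i => ⟨fun ω => (ω : E4) i, by fun_prop⟩

lemma sphPoly_apply (p : MvPolynomial (Fin 4) ℝ) (ω : S3) : sphPoly p ω = polyFun p ω := by
  induction p using MvPolynomial.induction_on with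
  | C a => simp [sphPoly, polyFun]
  | add p q hp hq => simp [map_add, hp, hq, polyFun]
  | mul_X p j hp =>
    have : sphPoly (X j) ω = (ω : E4) j := by simp [sphPoly]
    rw [map_mul, ContinuousMap.mul_apply, hp, this]
    simp [polyFun]

lemma denseRange_sphPoly : DenseRange sphPoly := by
  have h : sphPoly.range.SeparatesPoints := by
    intro ω₁ ω₂ hω
    have : ∃ i, (ω₁ : E4) i ≠ (ω₂ : E4) i := by
      by_contra! hc
      exact hω (Subtype.ext (PiLp.ext hc))
    obtain ⟨i, hi⟩ := this
    refine ⟨_, ⟨sphPoly (X i), ⟨X i, rfl⟩, rfl⟩, ?_⟩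
    simpa [sphPoly_apply, polyFun] using hi
  have h2 := ContinuousMap.subalgebra_topologicalClosure_eq_top_of_separatesPoints _ h
  rw [denseRange_iff_closure_range]
  have h3 := congrArg (fun A : Subalgebra ℝ C(S3, ℝ) => (A : Set C(S3, ℝ))) h2
  simpa [Subalgebra.topologicalClosure_coe] using h3

/-- The class in `L²` of the restriction of a polynomial to the unit sphere. -/
def polyL2 : MvPolynomial (Fin 4) ℝ →ₗ[ℝ] Lp ℝ 2 sphereMeasure :=
  (ContinuousMap.toLp 2 sphereMeasure ℝ).toLinearMap ∘ₗ sphPoly.toLinearMap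

lemma polyL2_apply (p : MvPolynomial (Fin 4) ℝ) :
    polyL2 p = ContinuousMap.toLp 2 sphereMeasure ℝ (sphPoly p) := rfl

lemma denseRange_polyL2 : DenseRange polyL2 :=
  (ContinuousMap.toLp_denseRange ℝ sphereMeasure ℝ (p := 2) (by simp)).comp denseRange_sphPoly
    (ContinuousMap.toLp 2 sphereMeasure ℝ).continuous

lemma inner_polyL2 (p q : MvPolynomial (Fin 4) ℝ) :
    inner ℝ (polyL2 p) (polyL2 q) = ∫ ω : S3, polyFun q ω * polyFun p ω ∂sphereMeasure := by
  rw [polyL2_apply, polyL2_apply, ContinuousMap.inner_toLp]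
  simp [sphPoly_apply]

lemma polyL2_eq_zero {p : MvPolynomial (Fin 4) ℝ} (h : polyL2 p = 0) (ω : S3) :
    polyFun p ω = 0 := by
  have h2 : sphPoly p = 0 := by
    apply ContinuousMap.toLp_injective (E := ℝ) (𝕜 := ℝ) (p := 2) sphereMeasure
    rw [← polyL2_apply, h, map_zero]
  rw [← sphPoly_apply, h2]
  rfl

lemma inner_polyL2_polySph (p q : MvPolynomial (Fin 4) ℝ) :
    inner ℝ (polyL2 (polySph p)) (polyL2 q) = inner ℝ (polyL2 p) (polyL2 (polySph q)) := by
  rw [inner_polyL2, inner_polyL2]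
  simp only [← sphLap_polyFun]
  rw [integral_sphLap_mul isOpen_univ (Set.subset_univ _) (contDiff_polyFun q).contDiffOn
    (contDiff_polyFun p).contDiffOn]

/-- The restrictions to the sphere of polynomials of degree less than `n`. -/
def polyL2LT (n : ℕ) : Submodule ℝ (Lp ℝ 2 sphereMeasure) := (polyLT n).map polyL2

instance (n : ℕ) : FiniteDimensional ℝ (polyL2LT n) := by
  unfold polyL2LT; infer_instance

lemma polyL2LT_mono {m n : ℕ} (h : m ≤ n) : polyL2LT m ≤ polyL2LT n :=
  Submodule.map_mono (polyLT_mono h)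

/-- The spherical harmonics of degree `n`. -/
def harmonicSpace (n : ℕ) : Submodule ℝ (Lp ℝ 2 sphereMeasure) :=
  (polyL2LT n)ᗮ ⊓ polyL2LT (n + 1)

instance (n : ℕ) : FiniteDimensional ℝ (harmonicSpace n) :=
  Submodule.finiteDimensional_of_le inf_le_right

lemma sphLap_eq_of_mem_harmonicSpace {n : ℕ} {p : MvPolynomial (Fin 4) ℝ} (hp : p ∈ polyLT (n + 1))
    (h : polyL2 p ∈ (polyL2LT n)ᗮ) (ω : S3) :
    sphLap (polyFun p) ω = -(n * (n + 2)) * polyFun p ω := by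
  set q := polySph p + ((n : ℝ) * (n + 2)) • p with hq
  have hqn : q ∈ polyLT n := polySph_add_smul_mem_polyLT hp
  have h1 : ∀ r ∈ polyLT n, inner ℝ (polyL2 r) (polyL2 p) = 0 := fun r hr =>
    h _ (Submodule.mem_map_of_mem hr)
  have h0 : inner ℝ (polyL2 q) (polyL2 q) = 0 := by
    have h3 : polyL2 q = polyL2 (polySph p) + ((n : ℝ) * (n + 2)) • polyL2 p := by
      rw [hq, map_add, map_smul]
    nth_rewrite 2 [h3]
    rw [inner_add_right, inner_smul_right, h1 q hqn, ← inner_polyL2_polySph,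
      h1 _ (polySph_mem_polyLT hqn), mul_zero, add_zero]
  have h2 := polyL2_eq_zero (inner_self_eq_zero.mp h0) ω
  rw [sphLap_polyFun]
  have h3 : polyFun q ω = polyFun (polySph p) ω + (n * (n + 2)) * polyFun p ω := by
    simp [hq, polyFun]
  linarith

lemma orthogonalFamily_harmonicSpace :
    OrthogonalFamily ℝ (fun n => harmonicSpace n) fun n => (harmonicSpace n).subtypeₗᵢ := by
  refine OrthogonalFamily.of_pairwise ?_
  have key : ∀ m n, m < n → harmonicSpace m ⟂ harmonicSpace n := by
    intro m n hmn
    refine Submodule.isOrtho_iff_inner_eq.mpr fun u hu v hv => ?_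
    exact hv.1 u (polyL2LT_mono hmn hu.2)
  intro m n hmn
  rcases lt_or_gt_of_ne hmn with h | h
  · exact key m n h
  · exact (key n m h).symm

lemma eq_zero_of_orthogonal_harmonicSpace {x : Lp ℝ 2 sphereMeasure}
    (hx : ∀ n, ∀ v ∈ harmonicSpace n, inner ℝ v x = 0) : x = 0 := by
  have h : ∀ n, polyL2LT n ≤ (Submodule.span ℝ {x})ᗮ := by
    intro n
    induction n with
    | zero => simp [polyL2LT, polyLT]
    | succ n ih =>
      rw [← Submodule.sup_orthogonal_inf_of_hasOrthogonalProjection (polyL2LT_mono (Nat.le_succ n))]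
      refine sup_le ih fun v hv => ?_
      rw [Submodule.mem_orthogonal_singleton_iff_inner_left]
      exact hx n v hv
  refine denseRange_polyL2.eq_zero_of_inner_right ℝ fun p => ?_
  obtain ⟨n, hn⟩ := exists_mem_polyLT p
  exact Submodule.mem_orthogonal_singleton_iff_inner_left.mp (h n (Submodule.mem_map_of_mem hn))

lemma exists_hilbertBasis_of_orthogonalFamily {E : Type*} [NormedAddCommGroup E]
    [InnerProductSpace ℝ E] [CompleteSpace E] {V : ℕ → Submodule ℝ E}
    [∀ n, FiniteDimensional ℝ (V n)]
    (hV : OrthogonalFamily ℝ (fun n => V n) fun n => (V n).subtypeₗᵢ)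
    (h : ∀ x : E, (∀ n, ∀ v ∈ V n, inner ℝ v x = 0) → x = 0) :
    ∃ B : HilbertBasis (Σ n, Fin (Module.finrank ℝ (V n))) ℝ E, ∀ a, B a ∈ V a.1 := by
  have hv := hV.orthonormal_sigma_orthonormal
    fun n => (stdOrthonormalBasis ℝ (V n)).orthonormal
  refine ⟨HilbertBasis.mkOfOrthogonalEqBot hv ?_, fun a => ?_⟩
  · rw [Submodule.eq_bot_iff]
    intro x hx
    refine h x fun n u hu => ?_
    have h1 := (stdOrthonormalBasis ℝ (V n)).sum_repr ⟨u, hu⟩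
    have h2 := congrArg (fun w : V n => (w : E)) h1
    simp only [Submodule.coe_sum, Submodule.coe_smul] at h2
    rw [← h2, sum_inner]
    refine Finset.sum_eq_zero fun a _ => ?_
    have h3 : inner ℝ (stdOrthonormalBasis ℝ (V n) a : E) x = 0 :=
      hx _ (Submodule.subset_span ⟨⟨n, a⟩, rfl⟩)
    rw [inner_smul_left, h3, mul_zero]
  · rw [HilbertBasis.coe_mkOfOrthogonalEqBot]
    exact (stdOrthonormalBasis ℝ (V a.1) a.2).2

/-- There is a Hilbert basis of `L²(S³)` consisting of spherical harmonics. -/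
theorem exists_hilbertBasis_sphericalHarmonics :
    ∃ (ι : Type) (_ : Countable ι) (B : HilbertBasis ι ℝ (Lp ℝ 2 sphereMeasure)) (n : ι → ℕ)
      (Y : ι → E4 → ℝ), (∀ j, ContDiff ℝ (⊤ : ℕ∞) (Y j)) ∧
      (∀ j, B j =ᵐ[sphereMeasure] fun ω => Y j ω) ∧
      (∀ j (ω : S3), sphLap (Y j) ω = -(n j * (n j + 2)) * Y j ω) ∧
      (∀ j, n j = 0 → ∃ c, ∀ x, Y j x = c) := by
  obtain ⟨B, hB⟩ := exists_hilbertBasis_of_orthogonalFamily orthogonalFamily_harmonicSpace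
    fun x => eq_zero_of_orthogonal_harmonicSpace
  have hP : ∀ a : Σ n, Fin (Module.finrank ℝ (harmonicSpace n)),
      ∃ p ∈ polyLT (a.1 + 1), polyL2 p = B a := fun a => (hB a).2
  choose P hP1 hP2 using hP
  refine ⟨_, inferInstance, B, fun a => a.1,
    fun a => polyFun (P a), fun a => contDiff_polyFun _, fun a => ?_, fun a ω => ?_,
    fun a ha => ?_⟩
  · rw [← hP2, polyL2_apply]
    filter_upwards [ContinuousMap.coeFn_toLp (p := 2) (𝕜 := ℝ) sphereMeasure (sphPoly (P a))]
      with ω hω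
    rw [hω, sphPoly_apply]
  · exact sphLap_eq_of_mem_harmonicSpace (hP1 a) (by rw [hP2]; exact (hB a).1) ω
  · have := hP1 a
    rw [show a.1 = 0 from ha] at this
    exact exists_const_of_mem_polyLT_one this

end SphericalHarmonics

section Parseval

variable {a b : ℝ} {f : E4 → ℝ}

lemma ContinuousOn.continuous_exp_smul (hf : ContinuousOn f (annulus a b)) {t : ℝ}
    (ht : t ∈ Set.Icc a b) : Continuous fun ω : S3 => f (Real.exp t • (ω : E4)) :=
  hf.comp_continuous (by fun_prop) fun ω => (exp_smul_mem_annulus ω).mpr ht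

lemma continuousOn_sphCoeff (hf : ContinuousOn f (annulus a b)) {Y : E4 → ℝ} (hY : Continuous Y) :
    ContinuousOn (sphCoeff f Y) (Set.Icc a b) := by
  refine continuousOn_integral_of_compact_support (μ := sphereMeasure) (k := Set.univ)
    isCompact_univ ?_ (fun _ ω _ hω => absurd (Set.mem_univ ω) hω)
  refine ContinuousOn.mul (hf.comp (f := fun p : ℝ × S3 => Real.exp p.1 • (p.2 : E4))
    (by fun_prop) fun p hp => (exp_smul_mem_annulus _).mpr hp.1) (by fun_prop)

/-- The integral of `f ^ 2` over the sphere of radius `exp t`, seen from the unit sphere. -/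
def sphEnergy (f : E4 → ℝ) (t : ℝ) : ℝ :=
  ∫ ω : S3, f (Real.exp t • (ω : E4)) ^ 2 ∂sphereMeasure

lemma continuousOn_sphEnergy (hf : ContinuousOn f (annulus a b)) :
    ContinuousOn (sphEnergy f) (Set.Icc a b) := by
  have h := continuousOn_sphCoeff (f := fun x => f x ^ 2) (hf.pow 2)
    (Y := fun _ => 1) continuous_const
  exact h.congr fun t _ => by simp [sphCoeff, sphEnergy]

lemma eq_zero_of_sphEnergy_eq_zero (hf : ContinuousOn f (annulus a b)) {t : ℝ}
    (ht : t ∈ Set.Icc a b) (h : sphEnergy f t = 0) (ω : S3) : f (Real.exp t • (ω : E4)) = 0 := by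
  have hc := (hf.continuous_exp_smul ht).pow 2
  have hi : Integrable (fun ω : S3 => f (Real.exp t • (ω : E4)) ^ 2) sphereMeasure :=
    hc.integrable_of_hasCompactSupport (HasCompactSupport.of_compactSpace _)
  have h2 := (integral_eq_zero_iff_of_nonneg (fun ω => sq_nonneg _) hi).mp h
  have h3 := (hc.ae_eq_iff_eq sphereMeasure continuous_const).mp h2
  exact pow_eq_zero_iff (two_ne_zero) |>.mp (congrFun h3 ω)

variable {ι : Type} {B : HilbertBasis ι ℝ (Lp ℝ 2 sphereMeasure)} {Y : ι → E4 → ℝ}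

lemma hasSum_sphCoeff_sq (hB : ∀ j, B j =ᵐ[sphereMeasure] fun ω => Y j ω)
    (hf : ContinuousOn f (annulus a b)) {t : ℝ} (ht : t ∈ Set.Icc a b) :
    HasSum (fun j => sphCoeff f (Y j) t ^ 2) (sphEnergy f t) := by
  let g : C(S3, ℝ) := ⟨_, hf.continuous_exp_smul ht⟩
  set x := ContinuousMap.toLp 2 sphereMeasure ℝ g with hx
  have hxg : x =ᵐ[sphereMeasure] g := ContinuousMap.coeFn_toLp sphereMeasure g
  have h := B.hasSum_inner_mul_inner x x
  have e1 : ∀ j, inner ℝ x (B j) = sphCoeff f (Y j) t := by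
    intro j
    rw [L2.inner_def, sphCoeff]
    refine integral_congr_ae ?_
    filter_upwards [hxg, hB j] with ω h1 h2
    rw [h1, h2]
    exact mul_comm _ _
  have e2 : inner ℝ x x = sphEnergy f t := by
    rw [hx, ContinuousMap.inner_toLp, sphEnergy]
    refine integral_congr_ae (Filter.Eventually.of_forall fun ω => ?_)
    simp only [conj_trivial, sq]
    rfl
  have e3 : ∀ j, inner ℝ (B j) x = sphCoeff f (Y j) t := fun j => by
    rw [real_inner_comm, e1]
  rw [e2] at h
  simpa only [e1, e3, ← sq] using h

lemma hasSum_integral_sphCoeff_sq [Countable ι] (hB : ∀ j, B j =ᵐ[sphereMeasure] fun ω => Y j ω)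
    (hY : ∀ j, Continuous (Y j)) (hab : a ≤ b) (hf : ContinuousOn f (annulus a b)) :
    HasSum (fun j => ∫ t in a..b, sphCoeff f (Y j) t ^ 2)
      (∫ x in annulus a b, f x ^ 2 / ‖x‖ ^ 4) := by
  have hI : Set.uIoc a b ⊆ Set.Icc a b := by
    rw [Set.uIoc_of_le hab]; exact Set.Ioc_subset_Icc_self
  rw [setIntegral_annulus hab (g := fun x => f x ^ 2) (hf.pow 2)]
  refine intervalIntegral.hasSum_integral_of_dominated_convergence
    (fun j t => sphCoeff f (Y j) t ^ 2) (fun j => ?_) (fun j => ?_) ?_ ?_ ?_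
  · exact (((continuousOn_sphCoeff hf (hY j)).pow 2).mono hI).aestronglyMeasurable
      measurableSet_uIoc
  · exact Filter.Eventually.of_forall fun t _ => by simp
  · exact Filter.Eventually.of_forall fun t ht => (hasSum_sphCoeff_sq hB hf (hI ht)).summable
  · have h1 : IntervalIntegrable (sphEnergy f) volume a b :=
      ContinuousOn.intervalIntegrable (by rw [Set.uIcc_of_le hab]; exact continuousOn_sphEnergy hf)
    refine h1.congr fun t ht => ?_
    exact (hasSum_sphCoeff_sq hB hf (hI ht)).tsum_eq.symm
  · exact Filter.Eventually.of_forall fun t ht => hasSum_sphCoeff_sq hB hf (hI ht)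

end Parseval

lemma annulus_mono {a b c d : ℝ} (hac : a ≤ c) (hdb : d ≤ b) : annulus c d ⊆ annulus a b :=
  fun _ hx => ⟨(Real.exp_le_exp.mpr hac).trans hx.1, hx.2.trans (Real.exp_le_exp.mpr hdb)⟩

theorem three_annuli_biharmonic {τ : ℝ} {f : E4 → ℝ}
    (hf : ContDiffOn ℝ (⊤ : ℕ∞) f (annulus (τ - 9 / 2) (τ + 9 / 2)))
    (hbi : ∀ x ∈ openAnnulus (τ - 9 / 2) (τ + 9 / 2), lap (lap f) x = 0)
    (hne : ∃ x ∈ annulus (τ - 9 / 2) (τ + 9 / 2), f x ≠ 0)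
    (hmean : ∀ t ∈ Set.Icc (τ - 9 / 2) (τ + 9 / 2),
      ∫ x in sphere (0 : E4) (Real.exp t), f x ∂(μH[3]) = 0) :
    2 * ∫ x in annulus (τ - 3 / 2) (τ + 3 / 2), f x ^ 2 / ‖x‖ ^ 4
      < Real.exp (-3) * ((∫ x in annulus (τ + 3 / 2) (τ + 9 / 2), f x ^ 2 / ‖x‖ ^ 4)
        + ∫ x in annulus (τ - 9 / 2) (τ - 3 / 2), f x ^ 2 / ‖x‖ ^ 4) := by
  obtain ⟨ι, _, B, n, Y, hY, hB, hYn, hY0⟩ := exists_hilbertBasis_sphericalHarmonics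
  have hfc := hf.continuousOn
  have hfo : ContDiffOn ℝ (⊤ : ℕ∞) f (openAnnulus (τ - 9 / 2) (τ + 9 / 2)) :=
    hf.mono fun x hx => ⟨hx.1.le, hx.2.le⟩
  have hYc : ∀ j, Continuous (Y j) := fun j => (hY j).continuous
  have h1 := (hasSum_integral_sphCoeff_sq hB hYc (by linarith)
    (hfc.mono (annulus_mono (c := τ - 3 / 2) (d := τ + 3 / 2) (by linarith)
      (by linarith)))).mul_left 2
  have h2 := ((hasSum_integral_sphCoeff_sq hB hYc (by linarith)
    (hfc.mono (annulus_mono (c := τ + 3 / 2) (d := τ + 9 / 2) (by linarith)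
      (by linarith)))).add (hasSum_integral_sphCoeff_sq hB hYc (by linarith)
    (hfc.mono (annulus_mono (c := τ - 9 / 2) (d := τ - 3 / 2) (by linarith)
      (by linarith))))).mul_left (Real.exp (-3))
  have hstrict : ∀ j, (∃ t ∈ Set.Ioo (τ - 9 / 2) (τ + 9 / 2), sphCoeff f (Y j) t ≠ 0) →
      2 * ∫ t in (τ - 3 / 2)..(τ + 3 / 2), sphCoeff f (Y j) t ^ 2
        < Real.exp (-3) * ((∫ t in (τ + 3 / 2)..(τ + 9 / 2), sphCoeff f (Y j) t ^ 2)
          + ∫ t in (τ - 9 / 2)..(τ - 3 / 2), sphCoeff f (Y j) t ^ 2) := by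
    intro j hj
    have hk : 1 ≤ n j := by
      by_contra! hn
      obtain ⟨c, hc⟩ := hY0 j (by omega)
      obtain ⟨t, ht, hne⟩ := hj
      refine hne ?_
      have ht' := Set.Ioo_subset_Icc_self ht
      have := integral_sphere_comp_smul_eq_zero (Real.exp_pos t) (hfc.mono fun x hx => ?_)
        (hmean t ht')
      · simp only [sphCoeff, hc, integral_mul_const, this, zero_mul]
      · rw [mem_sphere_zero_iff_norm] at hx
        exact ⟨by rw [hx]; exact Real.exp_le_exp.mpr ht'.1,
          by rw [hx]; exact Real.exp_le_exp.mpr ht'.2⟩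
    obtain ⟨c₁, c₂, c₃, c₄, hc⟩ := sphCoeff_eq_exp_sum hfo hbi (hY j) hk (hYn j)
    exact exp_sum_three_intervals (n j) hk c₁ c₂ c₃ c₄ τ _ hc hj
  have hle : ∀ j, 2 * ∫ t in (τ - 3 / 2)..(τ + 3 / 2), sphCoeff f (Y j) t ^ 2
        ≤ Real.exp (-3) * ((∫ t in (τ + 3 / 2)..(τ + 9 / 2), sphCoeff f (Y j) t ^ 2)
          + ∫ t in (τ - 9 / 2)..(τ - 3 / 2), sphCoeff f (Y j) t ^ 2) := by
    intro j
    by_cases hj : ∃ t ∈ Set.Ioo (τ - 9 / 2) (τ + 9 / 2), sphCoeff f (Y j) t ≠ 0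
    · exact (hstrict j hj).le
    · push Not at hj
      have h0 : ∫ t in (τ - 3 / 2)..(τ + 3 / 2), sphCoeff f (Y j) t ^ 2 = 0 := by
        rw [intervalIntegral.integral_congr_Ioo_of_le (g := fun _ => 0) (by linarith)]
        · simp
        · intro t ht
          simp [hj t ⟨by linarith [ht.1], by linarith [ht.2]⟩]
      rw [h0, mul_zero]
      refine mul_nonneg (Real.exp_pos _).le (add_nonneg ?_ ?_) <;>
      exact intervalIntegral.integral_nonneg (by linarith) fun t _ => sq_nonneg _
  have hex : ∃ j, ∃ t ∈ Set.Ioo (τ - 9 / 2) (τ + 9 / 2), sphCoeff f (Y j) t ≠ 0 := by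
    by_contra! hc
    have hE : Set.EqOn (sphEnergy f) 0 (Set.Icc (τ - 9 / 2) (τ + 9 / 2)) := by
      refine Set.EqOn.of_subset_closure (s := Set.Ioo (τ - 9 / 2) (τ + 9 / 2)) (fun t ht => ?_)
        (continuousOn_sphEnergy hfc) continuousOn_const Set.Ioo_subset_Icc_self
        (by rw [closure_Ioo (by linarith)])
      have := hasSum_sphCoeff_sq hB hfc (Set.Ioo_subset_Icc_self ht)
      simp only [hc _ t ht, ne_eq, OfNat.ofNat_ne_zero, not_false_eq_true, zero_pow] at this
      exact this.unique hasSum_zero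
    obtain ⟨x, hx, hfx⟩ := hne
    have hx0 : 0 < ‖x‖ := (Real.exp_pos _).trans_le hx.1
    have hω : ‖x‖⁻¹ • x ∈ sphere (0 : E4) 1 := by
      rw [mem_sphere_zero_iff_norm, norm_smul, norm_inv, norm_norm, inv_mul_cancel₀ hx0.ne']
    have hxe : Real.exp (Real.log ‖x‖) • (‖x‖⁻¹ • x) = x := by
      rw [Real.exp_log hx0, smul_smul, mul_inv_cancel₀ hx0.ne', one_smul]
    have ht : Real.log ‖x‖ ∈ Set.Icc (τ - 9 / 2) (τ + 9 / 2) := by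
      rw [← exp_smul_mem_annulus ⟨_, hω⟩]
      simpa only [hxe] using hx
    have := eq_zero_of_sphEnergy_eq_zero hfc ht (hE ht) ⟨_, hω⟩
    rw [hxe] at this
    exact hfx this
  obtain ⟨j, hj⟩ := hex
  exact hasSum_lt hle (hstrict j hj) h1 h2

/-- Three circle lemma for biharmonic functions on annuli in ℝ⁴, with `L = 3`:
if `f` is smooth on the closed annulus `A_{i-1} ∪ A_i ∪ A_{i+1}`, biharmonic on its
interior, not identically zero, and has vanishing mean over every sphere `{|x| = r}`
(surface measure), then `2 F_i(f) < e^{-L} (F_{i-1}(f) + F_{i+1}(f))`. -/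
theorem three_circle_biharmonic (i : ℤ) (f : EuclideanSpace ℝ (Fin 4) → ℝ)
    (hsmooth : ContDiffOn ℝ (⊤ : ℕ∞) f
      {x : EuclideanSpace ℝ (Fin 4) |
        Real.exp (-((i : ℝ) + 1) * 3) ≤ ‖x‖ ∧ ‖x‖ ≤ Real.exp (-((i : ℝ) - 2) * 3)})
    (hbiharm : ∀ x : EuclideanSpace ℝ (Fin 4),
      Real.exp (-((i : ℝ) + 1) * 3) < ‖x‖ → ‖x‖ < Real.exp (-((i : ℝ) - 2) * 3) →
      lap (lap f) x = 0)
    (hnonzero : ∃ x : EuclideanSpace ℝ (Fin 4),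
      (Real.exp (-((i : ℝ) + 1) * 3) ≤ ‖x‖ ∧ ‖x‖ ≤ Real.exp (-((i : ℝ) - 2) * 3)) ∧ f x ≠ 0)
    (hmean : ∀ r : ℝ, Real.exp (-((i : ℝ) + 1) * 3) ≤ r → r ≤ Real.exp (-((i : ℝ) - 2) * 3) →
      ∫ x in Metric.sphere (0 : EuclideanSpace ℝ (Fin 4)) r, f x ∂(μH[3]) = 0) :
    2 * Fweight 3 i f < Real.exp (-3) * (Fweight 3 (i - 1) f + Fweight 3 (i + 1) f) := by
  set τ : ℝ := -3 * i + 3 / 2 with hτ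
  have ea : -((i : ℝ) + 1) * 3 = τ - 9 / 2 := by rw [hτ]; ring
  have eb : -((i : ℝ) - 2) * 3 = τ + 9 / 2 := by rw [hτ]; ring
  have e0 : Fweight 3 i f = ∫ x in annulus (τ - 3 / 2) (τ + 3 / 2), f x ^ 2 / ‖x‖ ^ 4 := by
    rw [Fweight, annulus, show -(i : ℝ) * 3 = τ - 3 / 2 by rw [hτ]; ring,
      show -((i : ℝ) - 1) * 3 = τ + 3 / 2 by rw [hτ]; ring]
  have e1 : Fweight 3 (i - 1) f
      = ∫ x in annulus (τ + 3 / 2) (τ + 9 / 2), f x ^ 2 / ‖x‖ ^ 4 := by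
    rw [Fweight, annulus, show -((i - 1 : ℤ) : ℝ) * 3 = τ + 3 / 2 by rw [hτ]; push_cast; ring,
      show -(((i - 1 : ℤ) : ℝ) - 1) * 3 = τ + 9 / 2 by rw [hτ]; push_cast; ring]
  have e2 : Fweight 3 (i + 1) f
      = ∫ x in annulus (τ - 9 / 2) (τ - 3 / 2), f x ^ 2 / ‖x‖ ^ 4 := by
    rw [Fweight, annulus, show -((i + 1 : ℤ) : ℝ) * 3 = τ - 9 / 2 by rw [hτ]; push_cast; ring,
      show -(((i + 1 : ℤ) : ℝ) - 1) * 3 = τ - 3 / 2 by rw [hτ]; push_cast; ring]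
  rw [ea, eb] at hsmooth hnonzero hbiharm hmean
  rw [e0, e1, e2]
  exact three_annuli_biharmonic hsmooth (fun x hx => hbiharm x hx.1 hx.2) hnonzero
    fun t ht => hmean _ (Real.exp_le_exp.mpr ht.1) (Real.exp_le_exp.mpr ht.2)
end
end

section
/- Let L = 3, let n ≥ 1 be an integer, and let (A,B,C,D) ∈ ℝ⁴ be not all zero. Define f(r) = A r^n + B r^{n+2} + C r^{−n} + D r^{−n−2} for r > 0, and for i ∈ {−1, 0, 1} set F_i = ∫_{e^{−iL}}^{e^{−(i−1)L}} f(r)² r^{−1} dr. Then 2·F₀ < e^{−L}·(F_{−1} + F₁). -/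
open Real

/-- A combination of the even and odd modes of frequencies `p` and `q`. -/
noncomputable def hyperbolicSum (p q a b c d s : ℝ) : ℝ :=
  a * cosh (p * s) + b * cosh (q * s) + c * sinh (p * s) + d * sinh (q * s)

/-- The odd part of a primitive of `hyperbolicSum p q a b c d ^ 2`. -/
noncomputable def hyperbolicPrimitiveOdd (p q a b c d s : ℝ) : ℝ :=
  a ^ 2 * (sinh (2 * p * s) / (4 * p) + s / 2) + b ^ 2 * (sinh (2 * q * s) / (4 * q) + s / 2) +
    a * b * (sinh ((q + p) * s) / (q + p) + sinh ((q - p) * s) / (q - p)) +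
    c ^ 2 * (sinh (2 * p * s) / (4 * p) - s / 2) + d ^ 2 * (sinh (2 * q * s) / (4 * q) - s / 2) +
    c * d * (sinh ((q + p) * s) / (q + p) - sinh ((q - p) * s) / (q - p))

/-- The even part of a primitive of `hyperbolicSum p q a b c d ^ 2`. -/
noncomputable def hyperbolicPrimitiveEven (p q a b c d s : ℝ) : ℝ :=
  a * c * (cosh (2 * p * s) / (2 * p)) + b * d * (cosh (2 * q * s) / (2 * q)) +
    a * d * (cosh ((q + p) * s) / (q + p) + cosh ((q - p) * s) / (q - p)) +
    b * c * (cosh ((q + p) * s) / (q + p) - cosh ((q - p) * s) / (q - p))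

lemma hyperbolicPrimitiveOdd_neg (p q a b c d s : ℝ) :
    hyperbolicPrimitiveOdd p q a b c d (-s) = -hyperbolicPrimitiveOdd p q a b c d s := by
  simp only [hyperbolicPrimitiveOdd, mul_neg, sinh_neg]
  ring

lemma hyperbolicPrimitiveEven_neg (p q a b c d s : ℝ) :
    hyperbolicPrimitiveEven p q a b c d (-s) = hyperbolicPrimitiveEven p q a b c d s := by
  simp only [hyperbolicPrimitiveEven, mul_neg, cosh_neg]

lemma hasDerivAt_sinh_mul_div {k : ℝ} (hk : k ≠ 0) (s : ℝ) :
    HasDerivAt (fun t => sinh (k * t) / k) (cosh (k * s)) s := by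
  have h := (((hasDerivAt_id s).const_mul k).sinh).div_const k
  simpa [hk] using h

lemma hasDerivAt_cosh_mul_div {k : ℝ} (hk : k ≠ 0) (s : ℝ) :
    HasDerivAt (fun t => cosh (k * t) / k) (sinh (k * s)) s := by
  have h := (((hasDerivAt_id s).const_mul k).cosh).div_const k
  simpa [hk] using h

lemma hasDerivAt_hyperbolicPrimitive {p q : ℝ} (hp : p ≠ 0) (hq : q ≠ 0) (hadd : q + p ≠ 0)
    (hsub : q - p ≠ 0) (a b c d s : ℝ) :
    HasDerivAt (fun t => hyperbolicPrimitiveOdd p q a b c d t +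
      hyperbolicPrimitiveEven p q a b c d t) (hyperbolicSum p q a b c d s ^ 2) s := by
  have hsp := hasDerivAt_sinh_mul_div (mul_ne_zero two_ne_zero hp) s
  have hsq := hasDerivAt_sinh_mul_div (mul_ne_zero two_ne_zero hq) s
  have hsa := hasDerivAt_sinh_mul_div hadd s
  have hss := hasDerivAt_sinh_mul_div hsub s
  have hcp := hasDerivAt_cosh_mul_div (mul_ne_zero two_ne_zero hp) s
  have hcq := hasDerivAt_cosh_mul_div (mul_ne_zero two_ne_zero hq) s
  have hca := hasDerivAt_cosh_mul_div hadd s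
  have hcs := hasDerivAt_cosh_mul_div hsub s
  have hid := (hasDerivAt_id s).div_const 2
  have hodd := (((((((hsp.div_const 2).add hid).const_mul (a ^ 2)).add
    (((hsq.div_const 2).add hid).const_mul (b ^ 2))).add
    ((hsa.add hss).const_mul (a * b))).add
    (((hsp.div_const 2).sub hid).const_mul (c ^ 2))).add
    (((hsq.div_const 2).sub hid).const_mul (d ^ 2))).add
    ((hsa.sub hss).const_mul (c * d))
  have heven := (((hcp.const_mul (a * c)).add (hcq.const_mul (b * d))).add
    ((hca.add hcs).const_mul (a * d))).add ((hca.sub hcs).const_mul (b * c))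
  refine ((hodd.add heven).congr_deriv ?_).congr_of_eventuallyEq (.of_forall fun t => ?_)
  · have e1 : 2 * p * s = p * s + p * s := by ring
    have e2 : 2 * q * s = q * s + q * s := by ring
    have e3 : (q + p) * s = q * s + p * s := by ring
    have e4 : (q - p) * s = q * s - p * s := by ring
    simp only [hyperbolicSum, e1, e2, e3, e4, cosh_add, sinh_add, cosh_sub, sinh_sub]
    linear_combination (a ^ 2 / 2 - c ^ 2 / 2) * (-cosh_sq (p * s)) +
      (b ^ 2 / 2 - d ^ 2 / 2) * (-cosh_sq (q * s))
  · simp only [hyperbolicPrimitiveOdd, hyperbolicPrimitiveEven, Pi.add_apply, Pi.sub_apply, id]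
    ring

lemma integral_Icc_exp_div (f : ℝ → ℝ) (hf : ContinuousOn f (Set.Ioi 0)) {a b : ℝ}
    (hab : a ≤ b) :
    ∫ r in Set.Icc (exp a) (exp b), f r ^ 2 / r = ∫ t in a..b, f (exp t) ^ 2 := by
  rw [MeasureTheory.integral_Icc_eq_integral_Ioc,
    ← intervalIntegral.integral_of_le (exp_le_exp.2 hab),
    ← intervalIntegral.integral_comp_mul_deriv' (f := exp) (f' := exp)
      (g := fun r => f r ^ 2 / r) (fun x _ => hasDerivAt_exp x) continuous_exp.continuousOn]
  · refine intervalIntegral.integral_congr fun t _ => ?_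
    simp [(exp_pos t).ne']
  · rintro r ⟨t, -, rfl⟩
    have h := (hf.continuousAt (Ioi_mem_nhds (exp_pos t)))
    exact ((h.pow 2).div continuousAt_id (exp_pos t).ne').continuousWithinAt

lemma integral_hyperbolicSum_sq {p q : ℝ} (hp : p ≠ 0) (hq : q ≠ 0) (hadd : q + p ≠ 0)
    (hsub : q - p ≠ 0) (a b c d v x y : ℝ) :
    ∫ t in x..y, hyperbolicSum p q a b c d (t - v) ^ 2 =
      (hyperbolicPrimitiveOdd p q a b c d (y - v) + hyperbolicPrimitiveEven p q a b c d (y - v)) -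
      (hyperbolicPrimitiveOdd p q a b c d (x - v) +
        hyperbolicPrimitiveEven p q a b c d (x - v)) := by
  rw [intervalIntegral.integral_comp_sub_right (fun s => hyperbolicSum p q a b c d s ^ 2),
    intervalIntegral.integral_eq_sub_of_hasDerivAt
      (fun s _ => hasDerivAt_hyperbolicPrimitive hp hq hadd hsub a b c d s)]
  refine Continuous.intervalIntegrable ?_ _ _
  unfold hyperbolicSum
  fun_prop

lemma quadratic_form_pos {X Y Z : ℝ} (hX : 0 < X) (h : Z ^ 2 < X * Y) {a b : ℝ}
    (hab : ¬(a = 0 ∧ b = 0)) : 0 < X * a ^ 2 + 2 * Z * (a * b) + Y * b ^ 2 := by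
  have key : X * (X * a ^ 2 + 2 * Z * (a * b) + Y * b ^ 2) =
      (X * a + Z * b) ^ 2 + (X * Y - Z ^ 2) * b ^ 2 := by ring
  refine pos_of_mul_pos_right (a := X) ?_ hX.le
  rw [key]
  by_cases hb : b = 0
  · have ha : a ≠ 0 := fun ha => hab ⟨ha, hb⟩
    subst hb
    have : 0 < (X * a) ^ 2 := by positivity
    simpa using this
  · have : 0 < (X * Y - Z ^ 2) * b ^ 2 := mul_pos (by linarith) (by positivity)
    nlinarith [sq_nonneg (X * a + Z * b)]

lemma quadratic_form_nonneg {X Y Z : ℝ} (hX : 0 < X) (h : Z ^ 2 < X * Y) (a b : ℝ) :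
    0 ≤ X * a ^ 2 + 2 * Z * (a * b) + Y * b ^ 2 := by
  by_cases hab : a = 0 ∧ b = 0
  · simp [hab.1, hab.2]
  · exact (quadratic_form_pos hX h hab).le

/-- `exp (-3) * sinh (9 k) - (2 + exp (-3)) * sinh (3 k)`, the contribution of
`sinh (2 k s)` to the difference of the two sides of the three circle inequality. -/
noncomputable def sinhDefect (k : ℝ) : ℝ :=
  exp (-3) * sinh (9 * k) - (2 + exp (-3)) * sinh (3 * k)

lemma two_mul_sinhDefect (k : ℝ) : 2 * sinhDefect k =
    exp (3 * k) ^ 3 / exp 3 - (2 + 1 / exp 3) * exp (3 * k) +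
      ((2 + 1 / exp 3) * (exp (3 * k))⁻¹ - (exp (3 * k))⁻¹ ^ 3 / exp 3) := by
  have h : 9 * k = 3 * (3 * k) := by ring
  have h' : exp (3 * (3 * k)) = exp (3 * k) ^ 3 := by rw [← exp_nat_mul]; norm_num
  rw [sinhDefect, sinh_eq, sinh_eq, h, exp_neg, exp_neg, exp_neg, h']
  ring

lemma two_mul_sinhDefect_ge {k : ℝ} (hk : 0 ≤ k) :
    exp (3 * k) ^ 3 / exp 3 - (2 + 1 / exp 3) * exp (3 * k) ≤ 2 * sinhDefect k := by
  rw [two_mul_sinhDefect]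
  have hx : (exp (3 * k))⁻¹ ≤ 1 := inv_le_one_of_one_le₀ (one_le_exp (by positivity))
  have hx0 : 0 < (exp (3 * k))⁻¹ := by positivity
  set y := (exp (3 * k))⁻¹
  have hE : 0 < 1 / exp 3 := by positivity
  have h3 : y ^ 3 ≤ y := by nlinarith [mul_nonneg hx0.le (sub_nonneg.2 hx), sq_nonneg y]
  have : y ^ 3 / exp 3 ≤ (2 + 1 / exp 3) * y := by
    rw [div_eq_mul_one_div]
    nlinarith
  linarith

lemma two_mul_sinhDefect_le {k : ℝ} (hk : 0 ≤ k) :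
    2 * sinhDefect k ≤ exp (3 * k) ^ 3 / exp 3 := by
  rw [two_mul_sinhDefect]
  have hx1 : 1 ≤ exp (3 * k) := one_le_exp (by positivity)
  have hx : (exp (3 * k))⁻¹ ≤ exp (3 * k) := (inv_le_one_of_one_le₀ hx1).trans hx1
  have hE : 0 < 1 / exp 3 := by positivity
  have : 0 ≤ (exp (3 * k))⁻¹ ^ 3 / exp 3 := by positivity
  nlinarith

lemma twenty_le_exp_three : (20 : ℝ) ≤ exp 3 := by
  have h : exp 3 = exp 1 ^ 3 := by rw [← exp_nat_mul]; norm_num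
  rw [h]
  have := exp_one_gt_d9
  calc (20 : ℝ) ≤ 2.7182818283 ^ 3 := by norm_num
    _ ≤ _ := by gcongr

lemma sinhDefect_nonneg {k : ℝ} (hk : 1 ≤ k) : 0 ≤ sinhDefect k := by
  have h := two_mul_sinhDefect_ge (zero_le_one.trans hk)
  have hE := twenty_le_exp_three
  have hx : exp 3 ≤ exp (3 * k) := exp_le_exp.2 (by linarith)
  have : exp (3 * k) ^ 3 / exp 3 - (2 + 1 / exp 3) * exp (3 * k) =
      exp (3 * k) / exp 3 * (exp (3 * k) ^ 2 - (2 * exp 3 + 1)) := by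
    field_simp
  have : 0 ≤ exp (3 * k) / exp 3 * (exp (3 * k) ^ 2 - (2 * exp 3 + 1)) := by
    refine mul_nonneg (by positivity) ?_
    nlinarith
  linarith

lemma determinant_bound {N E x : ℝ} (hN : 2 ≤ N) (hE : 20 ≤ E) (hx : N * E ≤ 2 * x)
    (hx' : (N - 1) * E ≤ x) :
    0 < (x ^ 3 / E - (2 + 1 / E) * x) / (N - 1) - 12 ∧
    0 < (x ^ 3 * E ^ 5 - (2 + 1 / E) * (x * E ^ 2)) / (N + 1) - 12 ∧
    (x ^ 3 * E ^ 2 / N + E ^ 2) ^ 2 <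
      ((x ^ 3 / E - (2 + 1 / E) * x) / (N - 1) - 12) *
        ((x ^ 3 * E ^ 5 - (2 + 1 / E) * (x * E ^ 2)) / (N + 1) - 12) := by
  have hE0 : 0 < E := by linarith
  have hN0 : 0 < N := by linarith
  have hN1 : 0 < N - 1 := by linarith
  have hN2 : 0 < N + 1 := by linarith
  have hx10 : 10 * N ≤ x := by nlinarith
  have hx0 : 0 < x := by linarith
  have hxsq : (N * E) ^ 2 ≤ (2 * x) ^ 2 := by gcongr
  have h1 : x ^ 3 / (E * (N - 1)) * (1 - 0.54 / N ^ 2) ≤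
      (x ^ 3 / E - (2 + 1 / E) * x) / (N - 1) - 12 := by
    have key : N ^ 2 * ((2 * E + 1) * x + 12 * E * (N - 1)) ≤ 0.54 * x ^ 3 := by
      have s1 : (2 * E + 1) * x + 12 * E * (N - 1) ≤ (2 * E + 13) * x := by nlinarith
      have s2 : N ^ 2 * (2 * E + 13) ≤ 0.54 * x ^ 2 := by
        have : 2 * E + 13 ≤ 0.135 * E ^ 2 := by nlinarith
        have : N ^ 2 * (2 * E + 13) ≤ N ^ 2 * (0.135 * E ^ 2) := by gcongr
        nlinarith
      calc _ ≤ N ^ 2 * ((2 * E + 13) * x) := by gcongr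
        _ = N ^ 2 * (2 * E + 13) * x := by ring
        _ ≤ 0.54 * x ^ 2 * x := by gcongr
        _ = _ := by ring
    have e : (x ^ 3 / E - (2 + 1 / E) * x) / (N - 1) - 12 -
        x ^ 3 / (E * (N - 1)) * (1 - 0.54 / N ^ 2) =
        (0.54 * x ^ 3 - N ^ 2 * ((2 * E + 1) * x + 12 * E * (N - 1))) /
          (E * (N - 1) * N ^ 2) := by
      field_simp
      ring
    have : 0 ≤ (0.54 * x ^ 3 - N ^ 2 * ((2 * E + 1) * x + 12 * E * (N - 1))) /
          (E * (N - 1) * N ^ 2) := by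
      apply div_nonneg (by linarith)
      positivity
    linarith
  have h2 : x ^ 3 * E ^ 5 / (N + 1) * (1 - 0.05 / N ^ 2) ≤
      (x ^ 3 * E ^ 5 - (2 + 1 / E) * (x * E ^ 2)) / (N + 1) - 12 := by
    have key : N ^ 2 * ((2 + 1 / E) * (x * E ^ 2) + 12 * (N + 1)) ≤ 0.05 * (x ^ 3 * E ^ 5) := by
      have s0 : 1 / E ≤ 1 := by rw [div_le_one hE0]; linarith
      have s1 : (2 + 1 / E) * (x * E ^ 2) ≤ 3 * (x * E ^ 2) := by gcongr; linarith
      have s2 : 12 * (N + 1) ≤ x * E ^ 2 := by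
        have : 400 ≤ E ^ 2 := by nlinarith
        nlinarith
      have s3 : N ^ 2 ≤ x ^ 2 / 100 := by nlinarith
      have s4 : (1 : ℝ) ≤ E ^ 3 := one_le_pow₀ (by linarith)
      calc _ ≤ x ^ 2 / 100 * (4 * (x * E ^ 2)) := by gcongr; linarith
        _ = 0.04 * (x ^ 3 * E ^ 2) * 1 := by ring
        _ ≤ 0.05 * (x ^ 3 * E ^ 2) * E ^ 3 := by gcongr; norm_num
        _ = _ := by ring
    have e : (x ^ 3 * E ^ 5 - (2 + 1 / E) * (x * E ^ 2)) / (N + 1) - 12 -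
        x ^ 3 * E ^ 5 / (N + 1) * (1 - 0.05 / N ^ 2) =
        (0.05 * (x ^ 3 * E ^ 5) - N ^ 2 * ((2 + 1 / E) * (x * E ^ 2) + 12 * (N + 1))) /
          ((N + 1) * N ^ 2) := by
      field_simp
      ring
    have : 0 ≤ (0.05 * (x ^ 3 * E ^ 5) - N ^ 2 * ((2 + 1 / E) * (x * E ^ 2) + 12 * (N + 1))) /
          ((N + 1) * N ^ 2) := by
      apply div_nonneg (by linarith)
      positivity
    linarith
  have h3 : x ^ 3 * E ^ 2 / N + E ^ 2 ≤ x ^ 3 * E ^ 2 / N * (1 + 0.01 / N ^ 2) := by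
    have s : (10 * N) ^ 3 ≤ x ^ 3 := by gcongr
    have e : x ^ 3 * E ^ 2 / N * (1 + 0.01 / N ^ 2) - (x ^ 3 * E ^ 2 / N + E ^ 2) =
        E ^ 2 * (0.01 * x ^ 3 - N ^ 3) / N ^ 3 := by
      field_simp
      ring
    have : 0 ≤ E ^ 2 * (0.01 * x ^ 3 - N ^ 3) / N ^ 3 := by
      have : 0 ≤ 0.01 * x ^ 3 - N ^ 3 := by nlinarith [pow_pos hN0 3]
      positivity
    linarith
  have hN4 : 4 ≤ N ^ 2 := by nlinarith
  have hε : 1 / N ^ 2 ≤ 1 / 4 := by gcongr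
  have hε0 : 0 < 1 / N ^ 2 := by positivity
  have p1 : 0 < 1 - 0.54 / N ^ 2 := by
    have : 0.54 / N ^ 2 = 0.54 * (1 / N ^ 2) := by ring
    linarith
  have p2 : 0 < 1 - 0.05 / N ^ 2 := by
    have : 0.05 / N ^ 2 = 0.05 * (1 / N ^ 2) := by ring
    linarith
  have q1 : 0 < x ^ 3 / (E * (N - 1)) * (1 - 0.54 / N ^ 2) := by positivity
  have q2 : 0 < x ^ 3 * E ^ 5 / (N + 1) * (1 - 0.05 / N ^ 2) := by positivity
  refine ⟨q1.trans_le h1, q2.trans_le h2, ?_⟩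
  have hscalar : (N ^ 2 - 1) * (1 + 0.01 / N ^ 2) ^ 2 <
      N ^ 2 * ((1 - 0.54 / N ^ 2) * (1 - 0.05 / N ^ 2)) := by
    have hne : N ^ 2 ≠ 0 := by positivity
    generalize N ^ 2 = M at *
    have hM : 0 < M := by linarith
    rw [← sub_pos]
    have e : M * ((1 - 0.54 / M) * (1 - 0.05 / M)) - (M - 1) * (1 + 0.01 / M) ^ 2 =
        (0.39 * M ^ 2 + 0.0469 * M + 0.0001) / M ^ 2 := by
      field_simp
      ring
    rw [e]
    positivity
  calc (x ^ 3 * E ^ 2 / N + E ^ 2) ^ 2 ≤ (x ^ 3 * E ^ 2 / N * (1 + 0.01 / N ^ 2)) ^ 2 := by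
        gcongr
    _ = x ^ 6 * E ^ 4 / (N ^ 2 * (N - 1) * (N + 1)) *
        ((N ^ 2 - 1) * (1 + 0.01 / N ^ 2) ^ 2) := by
      field_simp
      ring
    _ < x ^ 6 * E ^ 4 / (N ^ 2 * (N - 1) * (N + 1)) *
        (N ^ 2 * ((1 - 0.54 / N ^ 2) * (1 - 0.05 / N ^ 2))) := by gcongr
    _ = x ^ 3 / (E * (N - 1)) * (1 - 0.54 / N ^ 2) *
        (x ^ 3 * E ^ 5 / (N + 1) * (1 - 0.05 / N ^ 2)) := by
      field_simp
    _ ≤ _ := by gcongr; exact q1.le.trans h1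

lemma natCast_mul_le_pow (n : ℕ) (hn : 1 ≤ n) {E : ℝ} (hE : 20 ≤ E) :
    ((n : ℝ) + 1) * E ≤ 2 * E ^ n ∧ (n : ℝ) * E ≤ E ^ n := by
  induction n, hn using Nat.le_induction with
  | base => norm_num
  | succ k hk ih =>
    have hk' : (1 : ℝ) ≤ k := by exact_mod_cast hk
    have hE0 : 0 < E ^ k := by positivity
    push_cast
    rw [pow_succ]
    constructor <;> nlinarith [ih.1, ih.2]

lemma sinhDefect_determinant (n : ℕ) (hn : 1 ≤ n) :
    0 < sinhDefect n / n - 6 ∧ 0 < sinhDefect (n + 2) / (n + 2) - 6 ∧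
    (sinhDefect (n + 1) / (n + 1) + sinhDefect 1) ^ 2 <
      (sinhDefect n / n - 6) * (sinhDefect (n + 2) / (n + 2) - 6) := by
  have hn' : (1 : ℝ) ≤ n := by exact_mod_cast hn
  have hE := twenty_le_exp_three
  obtain ⟨hg1, hg2⟩ := natCast_mul_le_pow n hn hE
  have hx : exp (3 * n) = exp 3 ^ n := by rw [← exp_nat_mul]; ring_nf
  rw [← hx] at hg1 hg2
  have hx1 : exp (3 * (n + 1)) = exp (3 * n) * exp 3 := by rw [← exp_add]; ring_nf
  have hx2 : exp (3 * (n + 2)) = exp (3 * n) * exp 3 ^ 2 := by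
    rw [← exp_nat_mul, ← exp_add]; push_cast; ring_nf
  have l0 := two_mul_sinhDefect_ge (k := n) (by linarith)
  have l2 := two_mul_sinhDefect_ge (k := n + 2) (by linarith)
  have u1 := two_mul_sinhDefect_le (k := n + 1) (by linarith)
  have u := two_mul_sinhDefect_le (k := 1) (by norm_num)
  have z1 := sinhDefect_nonneg (k := n + 1) (by linarith)
  have z := sinhDefect_nonneg (k := 1) le_rfl
  obtain ⟨d1, d2, d3⟩ := determinant_bound (N := n + 1) (x := exp (3 * n)) (by linarith) hE hg1
    (by simpa using hg2)
  rw [hx1] at u1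
  rw [hx2] at l2
  rw [mul_one] at u
  have r1 : (exp (3 * n) * exp 3) ^ 3 / exp 3 = exp (3 * n) ^ 3 * exp 3 ^ 2 := by field_simp
  have r2 : (exp (3 * n) * exp 3 ^ 2) ^ 3 / exp 3 = exp (3 * n) ^ 3 * exp 3 ^ 5 := by field_simp
  have r : exp 3 ^ 3 / exp 3 = exp 3 ^ 2 := by field_simp
  rw [r1] at u1
  rw [r2] at l2
  rw [r] at u
  have c1 : (n : ℝ) + 1 - 1 = n := by ring
  have c2 : (n : ℝ) + 1 + 1 = n + 2 := by ring
  rw [c1] at d1 d3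
  rw [c2] at d2 d3
  have b0 := div_le_div_of_nonneg_right l0 (by linarith : (0 : ℝ) ≤ n)
  have b2 := div_le_div_of_nonneg_right l2 (by linarith : (0 : ℝ) ≤ n + 2)
  have b1 := div_le_div_of_nonneg_right u1 (by linarith : (0 : ℝ) ≤ n + 1)
  rw [mul_div_assoc 2] at b0 b1 b2
  have w1 : 0 ≤ sinhDefect (n + 1) / (n + 1) := by positivity
  refine ⟨by linarith, by linarith, ?_⟩
  have hsq : (2 * (sinhDefect (n + 1) / (n + 1)) + 2 * sinhDefect 1) ^ 2 ≤
      (exp (3 * n) ^ 3 * exp 3 ^ 2 / (n + 1) + exp 3 ^ 2) ^ 2 := by gcongr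
  have hmul := mul_le_mul (sub_le_sub_right b0 12) (sub_le_sub_right b2 12) d2.le
    (d1.le.trans (sub_le_sub_right b0 12))
  linarith

lemma hyperbolicPrimitiveOdd_three_circle (n : ℕ) (hn : 1 ≤ n) {a b c d : ℝ}
    (h : ¬(a = 0 ∧ b = 0 ∧ c = 0 ∧ d = 0)) :
    (2 + exp (-3)) * hyperbolicPrimitiveOdd n (n + 2) a b c d (3 / 2) <
      exp (-3) * hyperbolicPrimitiveOdd n (n + 2) a b c d (9 / 2) := by
  obtain ⟨d1, d2, d3⟩ := sinhDefect_determinant n hn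
  have hn' : (1 : ℝ) ≤ n := by exact_mod_cast hn
  have z1 := sinhDefect_nonneg (k := n + 1) (by linarith)
  have z := sinhDefect_nonneg (k := 1) le_rfl
  have w1 : 0 ≤ sinhDefect (n + 1) / (n + 1) := by positivity
  have hp : 0 < exp (-3) := exp_pos _
  have hp1 : exp (-3) < 1 := exp_lt_one_iff.2 (by norm_num)
  have key : 4 * (exp (-3) * hyperbolicPrimitiveOdd n (n + 2) a b c d (9 / 2) -
      (2 + exp (-3)) * hyperbolicPrimitiveOdd n (n + 2) a b c d (3 / 2)) =
      ((sinhDefect n / n - 6 * (1 - exp (-3))) * a ^ 2 +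
        2 * (sinhDefect (n + 1) / (n + 1) + sinhDefect 1) * (a * b) +
        (sinhDefect (n + 2) / (n + 2) - 6 * (1 - exp (-3))) * b ^ 2) +
      ((sinhDefect n / n + 6 * (1 - exp (-3))) * c ^ 2 +
        2 * (sinhDefect (n + 1) / (n + 1) - sinhDefect 1) * (c * d) +
        (sinhDefect (n + 2) / (n + 2) + 6 * (1 - exp (-3))) * d ^ 2) := by
    have e1 : 2 * (n : ℝ) * (9 / 2) = 9 * n := by ring
    have e2 : 2 * (n : ℝ) * (3 / 2) = 3 * n := by ring
    have e3 : 2 * ((n : ℝ) + 2) * (9 / 2) = 9 * (n + 2) := by ring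
    have e4 : 2 * ((n : ℝ) + 2) * (3 / 2) = 3 * (n + 2) := by ring
    have e5 : ((n : ℝ) + 2 + n) * (9 / 2) = 9 * (n + 1) := by ring
    have e6 : ((n : ℝ) + 2 + n) * (3 / 2) = 3 * (n + 1) := by ring
    have e7 : ((n : ℝ) + 2 - n) * (9 / 2) = 9 * 1 := by ring
    have e8 : ((n : ℝ) + 2 - n) * (3 / 2) = 3 * 1 := by ring
    have e9 : (n : ℝ) + 2 + n = 2 * (n + 1) := by ring
    have e10 : (n : ℝ) + 2 - n = 2 := by ring
    simp only [hyperbolicPrimitiveOdd, sinhDefect, e1, e2, e3, e4, e5, e6, e7, e8]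
    rw [e9, e10]
    field_simp
    ring
  have hprod : (sinhDefect n / n - 6) * (sinhDefect (n + 2) / (n + 2) - 6) ≤
      (sinhDefect n / n - 6 * (1 - exp (-3))) *
        (sinhDefect (n + 2) / (n + 2) - 6 * (1 - exp (-3))) := by
    gcongr <;> linarith
  have hprod' : (sinhDefect n / n - 6) * (sinhDefect (n + 2) / (n + 2) - 6) ≤
      (sinhDefect n / n + 6 * (1 - exp (-3))) *
        (sinhDefect (n + 2) / (n + 2) + 6 * (1 - exp (-3))) := by
    gcongr <;> linarith
  have hX : 0 < sinhDefect n / n - 6 * (1 - exp (-3)) := by linarith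
  have hX' : 0 < sinhDefect n / n + 6 * (1 - exp (-3)) := by linarith
  have hdet := d3.trans_le hprod
  have hdet' : (sinhDefect (n + 1) / (n + 1) - sinhDefect 1) ^ 2 < _ :=
    lt_of_le_of_lt (by nlinarith) (d3.trans_le hprod')
  rw [← sub_pos]
  refine pos_of_mul_pos_right (a := 4) ?_ (by norm_num)
  rw [key]
  by_cases hab : a = 0 ∧ b = 0
  · exact add_pos_of_nonneg_of_pos (quadratic_form_nonneg hX hdet a b)
      (quadratic_form_pos hX' hdet' fun hcd => h ⟨hab.1, hab.2, hcd⟩)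
  · exact add_pos_of_pos_of_nonneg (quadratic_form_pos hX hdet hab)
      (quadratic_form_nonneg hX' hdet' c d)

/-- Single-mode three circle inequality with `L = 3`: for `n ≥ 1` and `(A,B,C,D) ≠ 0`,
with `f r = A rⁿ + B r^{n+2} + C r^{-n} + D r^{-n-2}` and
`F_i = ∫_{e^{-iL}}^{e^{-(i-1)L}} f(r)² r⁻¹ dr`, one has `2 F₀ < e^{-L} (F₋₁ + F₁)`. -/
theorem three_circle_single_mode (n : ℕ) (hn : 1 ≤ n) (A B C D : ℝ)
    (hABCD : ¬(A = 0 ∧ B = 0 ∧ C = 0 ∧ D = 0))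
    (f : ℝ → ℝ)
    (hf : ∀ r : ℝ, f r =
      A * r ^ (n : ℤ) + B * r ^ ((n : ℤ) + 2) + C * r ^ (-(n : ℤ)) + D * r ^ (-(n : ℤ) - 2))
    (F : ℤ → ℝ)
    (hF : ∀ i : ℤ, F i =
      ∫ r in Set.Icc (Real.exp (-(i : ℝ) * 3)) (Real.exp (-((i : ℝ) - 1) * 3)), (f r) ^ 2 / r) :
    2 * F 0 < Real.exp (-3) * (F (-1) + F 1) := by
  have hn' : (1 : ℝ) ≤ n := by exact_mod_cast hn
  have hcont : ContinuousOn f (Set.Ioi 0) := by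
    have : f = fun r => A * r ^ (n : ℤ) + B * r ^ ((n : ℤ) + 2) + C * r ^ (-(n : ℤ)) +
        D * r ^ (-(n : ℤ) - 2) := funext hf
    rw [this]
    have hz : ∀ m : ℤ, ContinuousOn (fun r : ℝ => r ^ m) (Set.Ioi 0) := fun m r hr =>
      (continuousAt_zpow₀ r m (Or.inl (ne_of_gt hr))).continuousWithinAt
    exact ((((hz _).const_smul A).add ((hz _).const_smul B)).add ((hz _).const_smul C)).add
      ((hz _).const_smul D)
  set P := exp (n * (3 / 2)) with hP
  set Q := exp ((n + 2) * (3 / 2)) with hQ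
  have hP0 : P ≠ 0 := (exp_pos _).ne'
  have hQ0 : Q ≠ 0 := (exp_pos _).ne'
  set a := A * P + C / P with ha
  set b := B * Q + D / Q with hb
  set c := A * P - C / P with hc
  set d := B * Q - D / Q with hd
  have hfexp : ∀ t, f (exp t) = hyperbolicSum n (n + 2) a b c d (t - 3 / 2) := by
    intro t
    have hz : ∀ m : ℤ, exp t ^ m = exp (m * t) := fun m => by
      rw [mul_comm, exp_mul, rpow_intCast]
    have hm1 : exp (n * t) = P * exp (n * (t - 3 / 2)) := by
      rw [hP, ← exp_add]; ring_nf
    have hm2 : exp ((n + 2) * t) = Q * exp ((n + 2) * (t - 3 / 2)) := by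
      rw [hQ, ← exp_add]; ring_nf
    have hm3 : -(n : ℝ) * t = -(n * t) := by ring
    have hm4 : (-(n : ℝ) - 2) * t = -((n + 2) * t) := by ring
    rw [hf, hz, hz, hz, hz]
    push_cast
    rw [hm3, hm4, exp_neg, exp_neg, hm1, hm2, hyperbolicSum, cosh_eq, cosh_eq, sinh_eq, sinh_eq,
      exp_neg, exp_neg, mul_inv, mul_inv, ha, hb, hc, hd]
    ring
  have habcd : ¬(a = 0 ∧ b = 0 ∧ c = 0 ∧ d = 0) := by
    rintro ⟨h1, h2, h3, h4⟩
    have hA : A * P = 0 := by linarith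
    have hB : B * Q = 0 := by linarith
    have hC : C / P = 0 := by linarith
    have hD : D / Q = 0 := by linarith
    simp only [mul_eq_zero, div_eq_zero_iff, hP0, hQ0, or_false] at hA hB hC hD
    exact hABCD ⟨hA, hB, hC, hD⟩
  have hadd : (n : ℝ) + 2 + n ≠ 0 := by positivity
  have hsub : (n : ℝ) + 2 - n ≠ 0 := by simp
  have hI := integral_hyperbolicSum_sq (p := n) (q := n + 2) (by positivity) (by positivity) hadd
    hsub a b c d (3 / 2)
  simp only [← hfexp] at hI
  have hFi : ∀ i : ℤ, F i = ∫ t in (-(i : ℝ) * 3)..(-((i : ℝ) - 1) * 3), f (exp t) ^ 2 :=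
    fun i => by rw [hF, integral_Icc_exp_div f hcont (by linarith)]
  have main := hyperbolicPrimitiveOdd_three_circle n hn habcd
  have e1 : -((0 : ℤ) : ℝ) * 3 - 3 / 2 = -(3 / 2) := by norm_num
  have e2 : -(((0 : ℤ) : ℝ) - 1) * 3 - 3 / 2 = 3 / 2 := by norm_num
  have e3 : -((1 : ℤ) : ℝ) * 3 - 3 / 2 = -(9 / 2) := by norm_num
  have e4 : -(((1 : ℤ) : ℝ) - 1) * 3 - 3 / 2 = -(3 / 2) := by norm_num
  have e5 : -((-1 : ℤ) : ℝ) * 3 - 3 / 2 = 3 / 2 := by norm_num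
  have e6 : -(((-1 : ℤ) : ℝ) - 1) * 3 - 3 / 2 = 9 / 2 := by norm_num
  rw [hFi, hFi, hFi, hI, hI, hI, e1, e2, e3, e4, e5, e6]
  simp only [hyperbolicPrimitiveOdd_neg, hyperbolicPrimitiveEven_neg]
  linarith
end

section
/- Let L = 3 and let n ≥ 2 be an integer. Define a = (e^{2nL}−1)(e^{(2n−1)L}+e^{−(2n+1)L}−2)/(2n), b = (e^{(2n+2)L}−1)(e^{(2n+1)L}+e^{−(2n+3)L}−2)/(2n+2), and c = (e^{(2n+4)L}−1)(e^{(2n+3)L}+e^{−(2n+5)L}−2)/(2n+4). Then for every x = (x₁,x₂) ∈ ℝ², a x₁² + 2b x₁x₂ + c x₂² ≥ (e^{(4n−1)L}/(24 n (n+1)²))·(x₁² + x₂²); that is, the smallest eigenvalue of the symmetric matrix [[a,b],[b,c]] is at least e^{(4n−1)L}/(24 n (n+1)²). -/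
open Real

/-- A binary quadratic form is nonnegative if its diagonal entries dominate `p > 0` and `r` with
`b² ≤ p r`. -/
lemma quadratic_form_nonneg_of_sq_le_mul {p r p' r' b : ℝ} (hp : 0 < p)
    (hpp' : p ≤ p') (hrr' : r ≤ r') (hb : b ^ 2 ≤ p * r) (x y : ℝ) :
    0 ≤ p' * x ^ 2 + 2 * b * x * y + r' * y ^ 2 := by
  have hform : 0 ≤ p * x ^ 2 + 2 * b * x * y + r * y ^ 2 := by
    refine nonneg_of_mul_nonneg_right (a := p) ?_ hp
    have h : p * (p * x ^ 2 + 2 * b * x * y + r * y ^ 2) =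
        (p * x + b * y) ^ 2 + (p * r - b ^ 2) * y ^ 2 := by ring
    rw [h]
    have := mul_nonneg (sub_nonneg.2 hb) (sq_nonneg y)
    positivity
  nlinarith [mul_le_mul_of_nonneg_right hpp' (sq_nonneg x),
    mul_le_mul_of_nonneg_right hrr' (sq_nonneg y)]

/-- The common correction factor of the matrix entries relative to their leading terms. -/
def correctionFactor (q u : ℝ) : ℝ := (1 - u) * (1 + u ^ 2 - 2 * q * u)

lemma le_correctionFactor {q u : ℝ} (hq : 1 ≤ q) (hq' : q ≤ 21) (hu : 0 ≤ u) (hu' : u ≤ 1) :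
    1 - 43 * u ≤ correctionFactor q u := by
  unfold correctionFactor
  have h₁ : q * u ≤ 21 * u := mul_le_mul_of_nonneg_right hq' hu
  have h₂ : 0 ≤ q * u * u := by positivity
  have h₃ : 0 ≤ u ^ 2 * (1 - u) := mul_nonneg (sq_nonneg u) (by linarith)
  nlinarith

lemma correctionFactor_le_one {q u : ℝ} (hq : 1 ≤ q) (hu : 0 ≤ u) (hu' : u ≤ 1) :
    correctionFactor q u ≤ 1 := by
  unfold correctionFactor
  have h₁ : 0 ≤ (q - 1) * u := mul_nonneg (by linarith) hu
  have h : (1 - u) * (1 + u ^ 2 - 2 * q * u) ≤ (1 - u) * 1 := by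
    apply mul_le_mul_of_nonneg_left _ (by linarith)
    nlinarith
  linarith

lemma mul_succ_sq_le_pow {n : ℕ} (hn : 2 ≤ n) : 860 * ((n : ℝ) + 1) ^ 2 ≤ 400 ^ n := by
  induction n, hn using Nat.le_induction with
  | base => norm_num
  | succ k hk ih =>
    rw [pow_succ (400 : ℝ)]
    push_cast
    nlinarith [(Nat.cast_nonneg k : (0 : ℝ) ≤ k)]

lemma twenty_lt_exp_three : 20 < exp 3 := by
  have h : exp 3 = exp 1 ^ 3 := by rw [← exp_nat_mul]; norm_num
  rw [h]
  calc (20 : ℝ) < 2.718 ^ 3 := by norm_num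
    _ ≤ exp 1 ^ 3 := by gcongr; linarith [exp_one_gt_d9]

lemma exp_three_lt_twentyOne : exp 3 < 21 := by
  have h : exp 3 = exp 1 ^ 3 := by rw [← exp_nat_mul]; norm_num
  rw [h]
  calc exp 1 ^ 3 ≤ 2.72 ^ 3 := by gcongr; linarith [exp_one_lt_d9]
    _ < 21 := by norm_num

/-- The quadratic form bound with the entries written through `q = e^L` and `E = q^{2n}`. -/
lemma quadratic_form_lower_bound {q E n : ℝ} (hq : 20 < q) (hq' : q < 21) (hn : 2 ≤ n)
    (hE : 860 * (n + 1) ^ 2 ≤ E) (x y : ℝ) :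
    E ^ 2 / q / (24 * n * (n + 1) ^ 2) * (x ^ 2 + y ^ 2) ≤
      E ^ 2 / q / (2 * n) * correctionFactor q (1 / E) * x ^ 2 +
      2 * (E ^ 2 * q ^ 3 / (2 * n + 2) * correctionFactor q (1 / (E * q ^ 2))) * x * y +
      E ^ 2 * q ^ 7 / (2 * n + 4) * correctionFactor q (1 / (E * q ^ 4)) * y ^ 2 := by
  have hq0 : 0 < q := by linarith
  have hn0 : 0 < n := by linarith
  have hE0 : 0 < E := lt_of_lt_of_le (by positivity) hE
  have hE1 : 1 / E ≤ 1 / (860 * (n + 1) ^ 2) := one_div_le_one_div_of_le (by positivity) hE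
  have small (k : ℕ) : 1 / (E * q ^ k) ≤ 1 / (860 * (n + 1) ^ 2) :=
    (one_div_le_one_div_of_le hE0
      (le_mul_of_one_le_right hE0.le (one_le_pow₀ (by linarith)))).trans hE1
  set δ : ℝ := 1 / (n + 1) ^ 2 with hδ
  have hδ0 : 0 < δ := by positivity
  have hδ1 : δ ≤ 1 / 9 := one_div_le_one_div_of_le (by norm_num) (by nlinarith)
  have hδ' : 1 / (860 * (n + 1) ^ 2) = δ / 860 := by rw [hδ]; field_simp
  rw [hδ'] at hE1
  simp only [hδ'] at small
  have hfa : 1 - δ / 20 ≤ correctionFactor q (1 / E) := by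
    have := le_correctionFactor (u := 1 / E) (by linarith) hq'.le (by positivity) (by linarith)
    linarith
  have hfc : 1 - δ / 20 ≤ correctionFactor q (1 / (E * q ^ 4)) := by
    have := le_correctionFactor (u := 1 / (E * q ^ 4)) (by linarith) hq'.le (by positivity)
      (by linarith [small 4])
    linarith [small 4]
  have hfb : 0 ≤ correctionFactor q (1 / (E * q ^ 2)) := by
    have := le_correctionFactor (u := 1 / (E * q ^ 2)) (by linarith) hq'.le (by positivity)
      (by linarith [small 2])
    linarith [small 2]
  have hfb' : correctionFactor q (1 / (E * q ^ 2)) ≤ 1 :=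
    correctionFactor_le_one (by linarith) (by positivity) (by linarith [small 2])
  set fa := correctionFactor q (1 / E)
  set fb := correctionFactor q (1 / (E * q ^ 2))
  set fc := correctionFactor q (1 / (E * q ^ 4))
  have hη : 0 < 1 - δ * (2 / 15) := by linarith
  have hlamA : E ^ 2 / q / (24 * n * (n + 1) ^ 2) = E ^ 2 / q / (2 * n) * (δ / 12) := by
    rw [hδ]; field_simp; norm_num
  have hlamC : E ^ 2 / q / (24 * n * (n + 1) ^ 2) ≤ E ^ 2 * q ^ 7 / (2 * n + 4) * (δ / 12) := by
    rw [hlamA]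
    refine mul_le_mul_of_nonneg_right ?_ (by positivity)
    rw [div_div, div_le_div_iff₀ (by positivity) (by positivity)]
    have h8 : 2 ≤ q ^ 8 := by
      calc (2 : ℝ) ≤ 20 ^ 8 := by norm_num
        _ ≤ q ^ 8 := by gcongr
    have h : 2 * n + 4 ≤ q ^ 8 * (2 * n) := by nlinarith
    calc E ^ 2 * (2 * n + 4) ≤ E ^ 2 * (q ^ 8 * (2 * n)) := by gcongr
      _ = E ^ 2 * q ^ 7 * (q * (2 * n)) := by ring
  have hA := mul_le_mul_of_nonneg_left hfa (by positivity : 0 ≤ E ^ 2 / q / (2 * n))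
  have hC := mul_le_mul_of_nonneg_left hfc (by positivity : 0 ≤ E ^ 2 * q ^ 7 / (2 * n + 4))
  have hB : (E ^ 2 * q ^ 3 / (2 * n + 2) * fb) ^ 2 ≤
      E ^ 2 / q / (2 * n) * (1 - δ * (2 / 15)) *
        (E ^ 2 * q ^ 7 / (2 * n + 4) * (1 - δ * (2 / 15))) := by
    have hprod : E ^ 2 / q / (2 * n) * (E ^ 2 * q ^ 7 / (2 * n + 4)) * (1 - δ) =
        (E ^ 2 * q ^ 3 / (2 * n + 2)) ^ 2 := by
      rw [hδ]; field_simp; ring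
    calc (E ^ 2 * q ^ 3 / (2 * n + 2) * fb) ^ 2 ≤ (E ^ 2 * q ^ 3 / (2 * n + 2) * 1) ^ 2 := by
          gcongr
      _ = E ^ 2 / q / (2 * n) * (E ^ 2 * q ^ 7 / (2 * n + 4)) * (1 - δ) := by
          rw [hprod, mul_one]
      _ ≤ E ^ 2 / q / (2 * n) * (E ^ 2 * q ^ 7 / (2 * n + 4)) * (1 - δ * (2 / 15)) ^ 2 := by
          gcongr
          nlinarith
      _ = _ := by ring
  have key := quadratic_form_nonneg_of_sq_le_mul
    (p := E ^ 2 / q / (2 * n) * (1 - δ * (2 / 15)))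
    (r := E ^ 2 * q ^ 7 / (2 * n + 4) * (1 - δ * (2 / 15)))
    (p' := E ^ 2 / q / (2 * n) * fa - E ^ 2 / q / (24 * n * (n + 1) ^ 2))
    (r' := E ^ 2 * q ^ 7 / (2 * n + 4) * fc - E ^ 2 / q / (24 * n * (n + 1) ^ 2))
    (by positivity) (by rw [hlamA]; linarith) (by linarith) hB x y
  linarith

/-- With `L = 3` and integer `n ≥ 2`, the smallest eigenvalue of the upper-left block
`𝒜 = [[a,b],[b,c]]` of `e^{-L}(M₋₁ + M₁) - 2M₀` is at least `e^{(4n-1)L}/(24 n (n+1)²)`: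
the quadratic form satisfies the corresponding lower bound. -/
theorem blockA_eigenvalue_lower_bound (n : ℕ) (hn : 2 ≤ n) (a b c : ℝ)
    (ha : a = (Real.exp (2 * (n : ℝ) * 3) - 1) *
        (Real.exp ((2 * (n : ℝ) - 1) * 3) + Real.exp (-(2 * (n : ℝ) + 1) * 3) - 2) / (2 * (n : ℝ)))
    (hb : b = (Real.exp ((2 * (n : ℝ) + 2) * 3) - 1) *
        (Real.exp ((2 * (n : ℝ) + 1) * 3) + Real.exp (-(2 * (n : ℝ) + 3) * 3) - 2) /
          (2 * (n : ℝ) + 2))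
    (hc : c = (Real.exp ((2 * (n : ℝ) + 4) * 3) - 1) *
        (Real.exp ((2 * (n : ℝ) + 3) * 3) + Real.exp (-(2 * (n : ℝ) + 5) * 3) - 2) /
          (2 * (n : ℝ) + 4))
    (x₁ x₂ : ℝ) :
    Real.exp ((4 * (n : ℝ) - 1) * 3) / (24 * (n : ℝ) * ((n : ℝ) + 1) ^ 2) * (x₁ ^ 2 + x₂ ^ 2) ≤
      a * x₁ ^ 2 + 2 * b * x₁ * x₂ + c * x₂ ^ 2 := by
  set q := exp 3 with hqdef
  set E := exp (2 * (n : ℝ) * 3) with hEdef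
  have hq := twenty_lt_exp_three
  have hq' := exp_three_lt_twentyOne
  rw [← hqdef] at hq hq'
  have hq0 : 0 < q := exp_pos _
  have hE0 : 0 < E := exp_pos _
  have hn' : (2 : ℝ) ≤ n := by exact_mod_cast hn
  have hEpow : E = (q ^ 2) ^ n := by
    rw [hEdef, hqdef, ← pow_mul, ← exp_nat_mul]
    push_cast
    ring_nf
  have hE : 860 * ((n : ℝ) + 1) ^ 2 ≤ E := by
    rw [hEpow]
    refine (mul_succ_sq_le_pow hn).trans ?_
    gcongr
    nlinarith
  have hpow (k : ℕ) : exp (2 * (n : ℝ) * 3 + k * 3) = E * q ^ k := by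
    rw [exp_add, exp_nat_mul]
  have hsub : exp ((2 * (n : ℝ) - 1) * 3) = E / q := by
    rw [hEdef, hqdef, ← exp_sub]; ring_nf
  have hadd (k : ℕ) : exp ((2 * (n : ℝ) + k) * 3) = E * q ^ k := by
    rw [← hpow]; ring_nf
  have hneg (k : ℕ) : exp (-(2 * (n : ℝ) + k) * 3) = (E * q ^ k)⁻¹ := by
    rw [← hadd, ← exp_neg]; ring_nf
  have hlam : exp ((4 * (n : ℝ) - 1) * 3) = E ^ 2 / q := by
    rw [hEdef, hqdef, ← exp_nat_mul, ← exp_sub]; push_cast; ring_nf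
  have h1 := hadd 1
  have h2 := hadd 2
  have h3 := hadd 3
  have h4 := hadd 4
  have h1' := hneg 1
  have h3' := hneg 3
  have h5' := hneg 5
  push_cast at h1 h2 h3 h4 h1' h3' h5'
  have hn0 : (0 : ℝ) < n := by linarith
  have ha' : a = E ^ 2 / q / (2 * n) * correctionFactor q (1 / E) := by
    rw [ha, hsub, h1', correctionFactor]
    field_simp
  have hb' : b = E ^ 2 * q ^ 3 / (2 * n + 2) * correctionFactor q (1 / (E * q ^ 2)) := by
    rw [hb, h2, h1, h3', correctionFactor]
    field_simp
  have hc' : c = E ^ 2 * q ^ 7 / (2 * n + 4) * correctionFactor q (1 / (E * q ^ 4)) := by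
    rw [hc, h4, h3, h5', correctionFactor]
    field_simp
  rw [hlam, ha', hb', hc']
  exact quadratic_form_lower_bound hq hq' hn' hE x₁ x₂
end

section
/- Let L = 3 and let n ≥ 2 be an integer. Define a = (1−e^{−2nL})(e^{−(2n+1)L}+e^{(2n−1)L}−2)/(2n), b = (1−e^{−(2n+2)L})(e^{−(2n+3)L}+e^{(2n+1)L}−2)/(2n+2), and c = (1−e^{−(2n+4)L})(e^{−(2n+5)L}+e^{(2n+3)L}−2)/(2n+4). Then for every x = (x₁,x₂) ∈ ℝ², a x₁² + 2b x₁x₂ + c x₂² ≥ (e^{(2n−1)L}/(12 n (n+1)²))·(x₁² + x₂²); that is, the smallest eigenvalue of the symmetric matrix [[a,b],[b,c]] is at least e^{(2n−1)L}/(12 n (n+1)²). -/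
open Real

/-- Each entry of the block, up to its denominator, lies within `3` below its leading exponential. -/
lemma entry_numerator_bounds {s : ℝ} (hs : 0 ≤ s) :
    exp ((s - 1) * 3) - 3 ≤ (1 - exp (-s * 3)) * (exp (-(s + 1) * 3) + exp ((s - 1) * 3) - 2) ∧
      (1 - exp (-s * 3)) * (exp (-(s + 1) * 3) + exp ((s - 1) * 3) - 2) ≤ exp ((s - 1) * 3) := by
  have hu : exp (-s * 3) ≤ 1 := exp_le_one_iff.2 (by linarith)
  have hv : exp (-(s + 1) * 3) ≤ 1 := exp_le_one_iff.2 (by linarith)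
  have huF : exp (-s * 3) * exp ((s - 1) * 3) ≤ 1 := by
    rw [← exp_add]
    exact exp_le_one_iff.2 (by linarith)
  have hu0 := exp_pos (-s * 3)
  have hv0 := exp_pos (-(s + 1) * 3)
  have hF0 := exp_pos ((s - 1) * 3)
  constructor
  · nlinarith [mul_nonneg (sub_nonneg.2 hu) hv0.le]
  · nlinarith [mul_nonneg (sub_nonneg.2 hu) (sub_nonneg.2 hv), mul_pos hu0 hF0]

lemma sq_le_exp_growth (n : ℕ) (hn : 2 ≤ n) :
    36 * ((n : ℝ) + 1) ^ 2 ≤ exp ((2 * (n : ℝ) - 1) * 3) := by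
  induction n, hn using Nat.le_induction with
  | base =>
    have h : exp ((2 * ((2 : ℕ) : ℝ) - 1) * 3) = exp 1 ^ 9 := by
      rw [← exp_nat_mul]
      norm_num
    have h2 : (2 : ℝ) ≤ exp 1 := by linarith [add_one_le_exp (1 : ℝ)]
    have h9 : (2 : ℝ) ^ 9 ≤ exp 1 ^ 9 := by gcongr
    rw [h]
    norm_num at h9 ⊢
    linarith
  | succ n hn ih =>
    have h : exp ((2 * ((n + 1 : ℕ) : ℝ) - 1) * 3) = exp ((2 * (n : ℝ) - 1) * 3) * exp 6 := by
      rw [← exp_add]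
      push_cast
      ring_nf
    have h6 : (7 : ℝ) ≤ exp 6 := by linarith [add_one_le_exp (6 : ℝ)]
    have hn' : (2 : ℝ) ≤ n := by exact_mod_cast hn
    rw [h]
    push_cast
    nlinarith [mul_le_mul ih h6 (by norm_num) (exp_pos _).le]

lemma quadratic_form_nonneg_s7 {p b r : ℝ} (hp : 0 < p) (h : b ^ 2 ≤ p * r) (x y : ℝ) :
    0 ≤ p * x ^ 2 + 2 * b * x * y + r * y ^ 2 := by
  refine nonneg_of_mul_nonneg_right (a := p) ?_ hp
  nlinarith [sq_nonneg (p * x + b * y), mul_nonneg (sub_nonneg.2 h) (sq_nonneg y)]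

/-- With `L = 3` and integer `n ≥ 2`, the smallest eigenvalue of the lower-right block
`𝒞 = [[a,b],[b,c]]` of `e^{-L}(M₋₁ + M₁) - 2M₀` is at least `e^{(2n-1)L}/(12 n (n+1)²)`:
the quadratic form satisfies the corresponding lower bound. -/
theorem blockC_eigenvalue_lower_bound (n : ℕ) (hn : 2 ≤ n) (a b c : ℝ)
    (ha : a = (1 - Real.exp (-(2 * (n : ℝ)) * 3)) *
        (Real.exp (-(2 * (n : ℝ) + 1) * 3) + Real.exp ((2 * (n : ℝ) - 1) * 3) - 2) / (2 * (n : ℝ)))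
    (hb : b = (1 - Real.exp (-(2 * (n : ℝ) + 2) * 3)) *
        (Real.exp (-(2 * (n : ℝ) + 3) * 3) + Real.exp ((2 * (n : ℝ) + 1) * 3) - 2) /
          (2 * (n : ℝ) + 2))
    (hc : c = (1 - Real.exp (-(2 * (n : ℝ) + 4) * 3)) *
        (Real.exp (-(2 * (n : ℝ) + 5) * 3) + Real.exp ((2 * (n : ℝ) + 3) * 3) - 2) /
          (2 * (n : ℝ) + 4))
    (x₁ x₂ : ℝ) :
    Real.exp ((2 * (n : ℝ) - 1) * 3) / (12 * (n : ℝ) * ((n : ℝ) + 1) ^ 2) * (x₁ ^ 2 + x₂ ^ 2) ≤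
      a * x₁ ^ 2 + 2 * b * x₁ * x₂ + c * x₂ ^ 2 := by
  have hn' : (2 : ℝ) ≤ n := by exact_mod_cast hn
  have hE := sq_le_exp_growth n hn
  obtain ⟨ha₁, -⟩ := entry_numerator_bounds (s := 2 * (n : ℝ)) (by linarith)
  obtain ⟨hb₁, hb₂⟩ := entry_numerator_bounds (s := 2 * (n : ℝ) + 2) (by linarith)
  obtain ⟨hc₁, -⟩ := entry_numerator_bounds (s := 2 * (n : ℝ) + 4) (by linarith)
  have hF : exp ((2 * (n : ℝ) + 1) * 3) = exp 6 * exp ((2 * (n : ℝ) - 1) * 3) := by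
    rw [← exp_add]
    ring_nf
  have hG : exp ((2 * (n : ℝ) + 3) * 3) = exp 6 ^ 2 * exp ((2 * (n : ℝ) - 1) * 3) := by
    rw [← exp_nat_mul, ← exp_add]
    ring_nf
  rw [show 2 * (n : ℝ) + 2 + 1 = 2 * n + 3 by ring,
    show 2 * (n : ℝ) + 2 - 1 = 2 * n + 1 by ring] at hb₁ hb₂
  rw [show 2 * (n : ℝ) + 4 + 1 = 2 * n + 5 by ring,
    show 2 * (n : ℝ) + 4 - 1 = 2 * n + 3 by ring] at hc₁
  have hQ : (7 : ℝ) ≤ exp 6 := by linarith [add_one_le_exp (6 : ℝ)]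
  rw [hF] at hb hb₁ hb₂
  rw [hG] at hc hc₁
  set N : ℝ := (n : ℝ)
  set E := exp ((2 * N - 1) * 3)
  set Q := exp (6 : ℝ)
  have hE0 : 0 < E := exp_pos _
  have hEm : 3 ≤ E / (12 * (N + 1) ^ 2) := by
    rw [le_div_iff₀ (by positivity)]
    linarith
  have hm : 1 / (4 * (N + 1) ^ 2) ≤ 1 / 36 := by
    apply one_div_le_one_div_of_le <;> nlinarith
  set t : ℝ := 1 - 1 / (4 * (N + 1) ^ 2) with ht
  set μ := E / (12 * N * (N + 1) ^ 2) with hμ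
  have ht0 : 0 < t := by linarith
  have hp : E / (2 * N) * t ≤ a - μ := by
    have h : (E - E / (12 * (N + 1) ^ 2)) / (2 * N) ≤ a := by
      rw [ha]
      gcongr
      linarith
    have h' : (E - E / (12 * (N + 1) ^ 2)) / (2 * N) - μ = E / (2 * N) * t := by
      rw [hμ, ht]
      field_simp
      ring
    linarith
  have hr : Q ^ 2 * E / (2 * N + 4) * t ≤ c - μ := by
    have h : (Q ^ 2 * E - E / (12 * (N + 1) ^ 2)) / (2 * N + 4) ≤ c := by
      rw [hc]
      gcongr
      linarith
    have h' : (Q ^ 2 * E - E / (12 * (N + 1) ^ 2)) / (2 * N + 4) - μ - Q ^ 2 * E / (2 * N + 4) * t =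
        E * (3 * N * Q ^ 2 - 3 * N - 4) / (12 * N * (N + 1) ^ 2 * (2 * N + 4)) := by
      rw [hμ, ht]
      field_simp
      ring
    have h'' : 0 ≤ E * (3 * N * Q ^ 2 - 3 * N - 4) / (12 * N * (N + 1) ^ 2 * (2 * N + 4)) := by
      have hQ2 : 49 ≤ Q ^ 2 := by nlinarith
      have : 0 ≤ 3 * N * Q ^ 2 - 3 * N - 4 := by
        linarith [mul_le_mul_of_nonneg_left hQ2 (by linarith : 0 ≤ N)]
      positivity
    linarith
  have hb0 : 0 ≤ b := by
    rw [hb]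
    have : 0 ≤ Q * E - 3 := by nlinarith
    exact div_nonneg (this.trans hb₁) (by positivity)
  have hbB : b ≤ Q * E / (2 * N + 2) := by
    rw [hb]
    gcongr
  have hdet : (Q * E / (2 * N + 2)) ^ 2 ≤ E / (2 * N) * t * (Q ^ 2 * E / (2 * N + 4) * t) := by
    have ht2 : N * (N + 2) / (N + 1) ^ 2 ≤ t ^ 2 := by
      have h : t ^ 2 - N * (N + 2) / (N + 1) ^ 2 =
          1 / (2 * (N + 1) ^ 2) + (1 / (4 * (N + 1) ^ 2)) ^ 2 := by
        rw [ht]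
        field_simp
        ring
      have : 0 ≤ 1 / (2 * (N + 1) ^ 2) + (1 / (4 * (N + 1) ^ 2)) ^ 2 := by positivity
      linarith
    calc (Q * E / (2 * N + 2)) ^ 2
        = Q ^ 2 * E ^ 2 / (4 * N * (N + 2)) * (N * (N + 2) / (N + 1) ^ 2) := by
          field_simp
          ring
      _ ≤ Q ^ 2 * E ^ 2 / (4 * N * (N + 2)) * t ^ 2 := by gcongr
      _ = _ := by
          field_simp
          ring
  have hP0 : 0 < E / (2 * N) * t := by positivity
  have hR0 : 0 ≤ Q ^ 2 * E / (2 * N + 4) * t := by positivity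
  have hbpr : b ^ 2 ≤ (a - μ) * (c - μ) :=
    (pow_le_pow_left₀ hb0 hbB 2).trans
      (hdet.trans (mul_le_mul hp hr hR0 (hP0.le.trans hp)))
  linarith [quadratic_form_nonneg_s7 (hP0.trans_le hp) hbpr x₁ x₂]
end
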